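/- The ratio of the total number of Hamiltonian paths on SG(n) to the number of Hamiltonian paths with one end at the outmost vertex o satisfies lim_{n→∞} H(n) / (H_0(n)·4^n) = 5^2·7·17/(2^8·3^2·13). -/

import Mathlib

open scoped Classical
open Filter Topology

noncomputable section

namespace SierpinskiGasket

/-- √3 -/
def sq3 : ℝ := Real.sqrt 3

/-- the origin, leftmost outmost vertex of every `SG n` -/
def o : ℝ × ℝ := (0, 0)

/-- `a m = (2^m, 0)`, the rightmost vertex of `SG m` (also a translation vector). -/
def a (m : ℕ) : ℝ × ℝ := ((2:ℝ) ^ m, 0)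

/-- `b m = (2^(m-1), 2^(m-1)·√3)`, the topmost vertex of `SG m`. -/
def b (m : ℕ) : ℝ × ℝ := ((2:ℝ) ^ m / 2, (2:ℝ) ^ m / 2 * sq3)

/-- `c m = (3·2^(m-1), 2^(m-1)·√3)`. -/
def c (m : ℕ) : ℝ × ℝ := (3 * (2:ℝ) ^ m / 2, (2:ℝ) ^ m / 2 * sq3)

/-- vertex set of `SG n` -/
def V : ℕ → Set (ℝ × ℝ)
  | 0 => {o, a 0, b 0}
  | n + 1 => V n ∪ ((· + a n) '' V n) ∪ ((· + b n) '' V n)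

/-- edge set of `SG n` -/
def E : ℕ → Set (Sym2 (ℝ × ℝ))
  | 0 => {s(o, a 0), s(o, b 0), s(a 0, b 0)}
  | n + 1 => E n ∪ (Sym2.map (· + a n) '' E n) ∪ (Sym2.map (· + b n) '' E n)

/-- `SG n` as a simple graph on `ℝ × ℝ` -/
def G (n : ℕ) : SimpleGraph (ℝ × ℝ) := SimpleGraph.fromEdgeSet (E n)

/-- a Hamiltonian path of `SG n`: a path visiting every vertex of `SG n` exactly once -/
def IsHamPath (n : ℕ) {u v : ℝ × ℝ} (p : (G n).Walk u v) : Prop :=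
  p.IsPath ∧ ∀ x, x ∈ p.support ↔ x ∈ V n

/-- a Hamiltonian cycle of `SG n` -/
def IsHamCycle (n : ℕ) {u : ℝ × ℝ} (p : (G n).Walk u u) : Prop :=
  p.IsCycle ∧ ∀ x, x ∈ p.support ↔ x ∈ V n

/-- `f n u v`: the number of Hamiltonian paths of `SG n` with end-vertex set `{u, v}`
(for `u ≠ v`, such unordered paths correspond bijectively to walks from `u` to `v`). -/
def f (n : ℕ) (u v : ℝ × ℝ) : ℕ := Nat.card {p : (G n).Walk u v // IsHamPath n p}

/-- `f1 n`: the number of Hamiltonian paths of `SG n` with end-vertex set `{o, a n}` -/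
def f1 (n : ℕ) : ℕ := f n o (a n)

/-- the number of Hamiltonian cycles of `SG n`, counted up to starting vertex and
orientation: every Hamiltonian cycle passes through `o` and has exactly two
representatives as a closed walk based at `o`. -/
def HC (n : ℕ) : ℕ := Nat.card {p : (G n).Walk o o // IsHamCycle n p} / 2

/-- the number of Hamiltonian paths of `SG n` having `o` as one of their end vertices -/
def H0 (n : ℕ) : ℕ := ∑ᶠ x ∈ {x : ℝ × ℝ | x ≠ o}, f n o x

/-- the total number of Hamiltonian paths of `SG n` (a path and its reversal
are the same unordered object, whence the division by `2`). -/
def H (n : ℕ) : ℕ := (∑ᶠ u : ℝ × ℝ, ∑ᶠ v : ℝ × ℝ, f n u v) / 2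

/-- the distribution ratio `F(n,x) = f(n,x)/f1(n)` -/
def F (n : ℕ) (x : ℝ × ℝ) : ℝ := (f n o x : ℝ) / (f1 n : ℝ)

/-- `SG n` with the vertex `b n` (and its incident edges) deleted -/
def Gd (n : ℕ) : SimpleGraph (ℝ × ℝ) := SimpleGraph.fromEdgeSet {e ∈ E n | b n ∉ e}

/-- Hamiltonian path of `SG n - b n` -/
def IsHamPathD (n : ℕ) {u v : ℝ × ℝ} (p : (Gd n).Walk u v) : Prop :=
  p.IsPath ∧ ∀ x, x ∈ p.support ↔ (x ∈ V n ∧ x ≠ b n)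

/-- `g2 n x`: the number of Hamiltonian paths of `SG n - b n` with end-vertex set `{o, x}` -/
def g2 (n : ℕ) (x : ℝ × ℝ) : ℕ := Nat.card {p : (Gd n).Walk o x // IsHamPathD n p}

/-- `g1 n`: the number of Hamiltonian paths of `SG n - b n` with end-vertex set `{o, a n}` -/
def g1 (n : ℕ) : ℕ := g2 n (a n)

/-- the distribution ratio `G₂(n,x) = g₂(n,x)/g₁(n)` -/
def G2 (n : ℕ) (x : ℝ × ℝ) : ℝ := (g2 n x : ℝ) / (g1 n : ℝ)

/-- mid-side vertex `a_{m,1} = (3·2^(m-1), 0)` -/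
def a1 (m : ℕ) : ℝ × ℝ := (3 * (2:ℝ) ^ m / 2, 0)

/-- mid-side vertex `b_{m,1} = (5·2^(m-2), 2^(m-2)·√3)` -/
def b1 (m : ℕ) : ℝ × ℝ := (5 * (2:ℝ) ^ m / 4, (2:ℝ) ^ m / 4 * sq3)

/-- mid-side vertex `c_{m,1} = (7·2^(m-2), 2^(m-2)·√3)` -/
def c1 (m : ℕ) : ℝ × ℝ := (7 * (2:ℝ) ^ m / 4, (2:ℝ) ^ m / 4 * sq3)

/-- mid-side vertex `a_{m,2} = (2^m, 2^(m-1)·√3)` -/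
def a2 (m : ℕ) : ℝ × ℝ := ((2:ℝ) ^ m, (2:ℝ) ^ m / 2 * sq3)

/-- mid-side vertex `b_{m,2} = (3·2^(m-2), 3·2^(m-2)·√3)` -/
def b2 (m : ℕ) : ℝ × ℝ := (3 * (2:ℝ) ^ m / 4, 3 * (2:ℝ) ^ m / 4 * sq3)

/-- mid-side vertex `c_{m,2} = (5·2^(m-2), 3·2^(m-2)·√3)` -/
def c2 (m : ℕ) : ℝ × ℝ := (5 * (2:ℝ) ^ m / 4, 3 * (2:ℝ) ^ m / 4 * sq3)

/-- exceptional vertex `a* = (2^(n-1), (2^(n-1)-1)·√3)` -/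
def astar (n : ℕ) : ℝ × ℝ := ((2:ℝ) ^ n / 2, ((2:ℝ) ^ n / 2 - 1) * sq3)

/-- exceptional vertex `b* = (2^(n-1) - 1/2, (2^n-1)·√3/2)` -/
def bstar (n : ℕ) : ℝ × ℝ := ((2:ℝ) ^ n / 2 - 1/2, ((2:ℝ) ^ n - 1) * sq3 / 2)

/-- exceptional vertex `c* = (2^(n-1) + 1/2, (2^n-1)·√3/2)` -/
def cstar (n : ℕ) : ℝ × ℝ := ((2:ℝ) ^ n / 2 + 1/2, ((2:ℝ) ^ n - 1) * sq3 / 2)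

/-- the Euclidean norm on `ℝ × ℝ` -/
def enorm (x : ℝ × ℝ) : ℝ := Real.sqrt (x.1 ^ 2 + x.2 ^ 2)

/-- the set `C n` of corner vertices of `SG n` -/
def C (n : ℕ) : Finset (ℝ × ℝ) :=
  ((Finset.range (n + 1)).image a) ∪ ((Finset.range (n + 1)).image b) ∪
    ((Finset.range n).image c)

/-- the mean `ℓ` displacement over the corner vertices -/
def xi' (n : ℕ) (ℓ : ℝ) : ℝ :=
  (∑ x ∈ C n, enorm x ^ ℓ * F n x) / (∑ x ∈ C n, F n x)

/-- `p(n,x)`: the probability that a Hamiltonian path with one end at `o`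
has its other end at `x` -/
def p (n : ℕ) (x : ℝ × ℝ) : ℝ := (f n o x : ℝ) / (H0 n : ℝ)

/-- the mean `ℓ` displacement of Hamiltonian paths on `SG n` with one end at `o` -/
def xi (n : ℕ) (ℓ : ℝ) : ℝ :=
  ∑ᶠ x ∈ {x : ℝ × ℝ | x ∈ V n ∧ x ≠ o}, enorm x ^ ℓ * p n x

/-- the partition function of Hamiltonian paths on `SG n` -/
def Z (n : ℕ) (β : ℝ) : ℝ := (H n : ℝ) * Real.exp (-(β * ((3 ^ (n + 1) + 1) / 2)))

/-- boundary data of a set of edges: the degrees of the three outmost vertices, and which pairs of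
outmost vertices are connected -/
structure St where
  d0 : ℕ
  d1 : ℕ
  d2 : ℕ
  c01 : Bool
  c02 : Bool
  c12 : Bool
deriving DecidableEq

namespace St

/-- number of connectivity classes among the outmost vertices -/
def classes (s : St) : ℕ :=
  bif s.c01 && s.c02 then 1 else bif s.c01 || (s.c02 || s.c12) then 2 else 3

/-- sum of the degrees of the outmost vertices -/
def degs (s : St) : ℕ := s.d0 + s.d1 + s.d2

/-- twice the number of classes plus the sum of the boundary degrees -/
def weight (s : St) : ℕ := 2 * s.classes + s.degs

/-- kernel-friendly equality test -/
def beq (s t : St) : Bool :=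
  s.d0.beq t.d0 && (s.d1.beq t.d1 && (s.d2.beq t.d2 &&
    (!(xor s.c01 t.c01) && (!(xor s.c02 t.c02) && !(xor s.c12 t.c12)))))

/-- symmetry class of a boundary state -/
def cls (s : St) : ℕ :=
  bif s.classes.beq 1 then bif s.degs.beq 4 then 0 else bif s.degs.beq 5 then 2 else 9
  else bif s.classes.beq 3 then
    bif s.degs.beq 0 then 8 else bif s.degs.beq 1 then 4 else
      bif s.d0.beq 2 || (s.d1.beq 2 || s.d2.beq 2) then 10 else 7
  else
    let z := bif s.c01 then s.d2 else bif s.c02 then s.d1 else s.d0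
    bif z.beq 0 then bif s.degs.beq 2 then 1 else bif s.degs.beq 3 then 3 else 10
    else bif z.beq 1 then bif s.degs.beq 3 then 5 else 6
    else 10

end St

/-- identify the labels of `i` and `j` if `t` holds -/
def merge (t : Bool) (i j : Fin 6) (l : Fin 6 → ℕ) : Fin 6 → ℕ :=
  bif t then fun x => bif Nat.beq (l x) (l i) then l j else l x else l

/-- labels of the connectivity classes of the six corner vertices after gluing -/
def glueLabel (A B C : St) : Fin 6 → ℕ :=
  merge C.c12 5 2 <| merge C.c02 4 2 <| merge C.c01 4 5 <|
  merge B.c12 1 5 <| merge B.c02 3 5 <| merge B.c01 3 1 <|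
  merge A.c12 3 4 <| merge A.c02 0 4 <| merge A.c01 0 3 <| fun i => i.val

/-- boundary state after gluing -/
def glueSt (A B C : St) : St where
  d0 := A.d0
  d1 := B.d1
  d2 := C.d2
  c01 := (glueLabel A B C 0).beq (glueLabel A B C 1)
  c02 := (glueLabel A B C 0).beq (glueLabel A B C 2)
  c12 := (glueLabel A B C 1).beq (glueLabel A B C 2)

/-- whether the `i`-th corner vertex is connected to an outmost vertex -/
def outer (A B C : St) (i : Fin 6) : Bool :=
  (glueLabel A B C i).beq (glueLabel A B C 0) ||
  ((glueLabel A B C i).beq (glueLabel A B C 1) || (glueLabel A B C i).beq (glueLabel A B C 2))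

/-- compatibility of three boundary states -/
def glueOK (A B C : St) : Bool :=
  (A.d1 + B.d0).ble 2 && ((A.d2 + C.d0).ble 2 && ((B.d2 + C.d1).ble 2 &&
  (outer A B C 3 && (outer A B C 4 && (outer A B C 5 &&
  ((glueSt A B C).classes + 3).beq (A.classes + B.classes + C.classes))))))

/-- the boundary states that can occur in a Hamiltonian path -/
def states : List St :=
  [⟨0, 0, 0, false, false, false⟩, ⟨0, 0, 1, false, false, false⟩,
   ⟨0, 0, 2, false, false, false⟩, ⟨0, 1, 0, false, false, false⟩,
   ⟨0, 1, 1, false, false, true⟩, ⟨0, 1, 1, false, false, false⟩,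
   ⟨0, 1, 2, false, false, true⟩, ⟨0, 2, 0, false, false, false⟩,
   ⟨0, 2, 1, false, false, true⟩, ⟨0, 2, 2, false, false, true⟩,
   ⟨1, 0, 0, false, false, false⟩, ⟨1, 0, 1, false, true, false⟩,
   ⟨1, 0, 1, false, false, false⟩, ⟨1, 0, 2, false, true, false⟩,
   ⟨1, 1, 0, true, false, false⟩, ⟨1, 1, 0, false, false, false⟩,
   ⟨1, 1, 1, true, false, false⟩, ⟨1, 1, 1, false, true, false⟩,
   ⟨1, 1, 1, false, false, true⟩, ⟨1, 1, 2, true, true, true⟩,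
   ⟨1, 1, 2, true, false, false⟩, ⟨1, 1, 2, false, true, false⟩,
   ⟨1, 1, 2, false, false, true⟩, ⟨1, 2, 0, true, false, false⟩,
   ⟨1, 2, 1, true, true, true⟩, ⟨1, 2, 1, true, false, false⟩,
   ⟨1, 2, 1, false, true, false⟩, ⟨1, 2, 1, false, false, true⟩,
   ⟨1, 2, 2, true, true, true⟩, ⟨2, 0, 0, false, false, false⟩,
   ⟨2, 0, 1, false, true, false⟩, ⟨2, 0, 2, false, true, false⟩,
   ⟨2, 1, 0, true, false, false⟩, ⟨2, 1, 1, true, true, true⟩,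
   ⟨2, 1, 1, true, false, false⟩, ⟨2, 1, 1, false, true, false⟩,
   ⟨2, 1, 1, false, false, true⟩, ⟨2, 1, 2, true, true, true⟩,
   ⟨2, 2, 0, true, false, false⟩, ⟨2, 2, 1, true, true, true⟩,
   ⟨2, 2, 2, true, true, true⟩]

/-- the boundary states whose counts matter -/
def live : List St := states.filter fun s => s.cls.ble 9

/-- the compatible triples with glued state `s` -/
def triples (s : St) : List (St × St × St) :=
  (states.filter fun A => A.d0.beq s.d0 && A.weight.ble s.weight).flatMap fun A =>
  (states.filter fun B => B.d1.beq s.d1 && ((A.d1 + B.d0).ble 2 &&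
    (A.weight + B.weight).ble (s.weight + 4 + (A.d1 + B.d0)))).flatMap fun B =>
  (states.filter fun C => C.d2.beq s.d2 &&
    ((s.classes + 3).beq (A.classes + B.classes + C.classes) &&
    ((glueSt A B C).beq s && glueOK A B C))).map fun C => (A, B, C)

/-- coefficients of the recursion for the counts -/
def coeffs : ℕ → List (ℕ × ℕ × ℕ × ℕ)
  | 0 => [(2, 0, 0, 1)]
  | 1 => [(1, 0, 0, 8), (2, 0, 1, 1)]
  | 2 => [(2, 0, 0, 1), (2, 0, 0, 3), (2, 0, 0, 5), (2, 0, 1, 2)]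
  | 3 =>
    [(1, 0, 0, 4), (1, 0, 0, 8), (2, 0, 1, 1), (2, 0, 1, 3), (2, 0, 1, 5), (1, 0, 2, 8),
     (1, 1, 1, 2)]
  | 4 => [(2, 0, 1, 4), (2, 0, 1, 8), (2, 0, 3, 8), (2, 1, 1, 1), (2, 1, 1, 3), (2, 1, 1, 5)]
  | 5 => [(1, 0, 0, 4), (4, 0, 1, 1), (2, 0, 1, 3), (6, 0, 1, 5), (1, 1, 1, 2)]
  | 6 =>
    [(1, 0, 0, 4), (1, 0, 0, 7), (1, 0, 1, 1), (4, 0, 1, 3), (4, 0, 1, 5), (4, 0, 1, 6),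
     (1, 0, 2, 4), (1, 0, 3, 3), (2, 0, 3, 5), (3, 0, 5, 5), (1, 1, 1, 2), (2, 1, 2, 3),
     (2, 1, 2, 5)]
  | 7 =>
    [(8, 0, 1, 4), (4, 0, 1, 7), (4, 0, 1, 8), (4, 0, 3, 4), (4, 0, 3, 8), (4, 0, 4, 5),
     (4, 0, 5, 8), (4, 0, 6, 8), (2, 1, 1, 1), (4, 1, 1, 3), (8, 1, 1, 5), (4, 1, 1, 6),
     (2, 1, 2, 4), (2, 1, 2, 8), (2, 1, 3, 3), (4, 1, 3, 5), (6, 1, 5, 5), (2, 2, 3, 8)]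
  | 8 => []
  | 9 => [(6, 0, 0, 3), (6, 0, 0, 6), (6, 0, 2, 3)]
  | _ => []

/-- code of the unordered triple `{i, j, k}` -/
def code (i j k : ℕ) : ℕ :=
  bif i.ble j then
    bif j.ble k then (i * 256 + j * 16) + k
    else bif i.ble k then (i * 256 + k * 16) + j else (k * 256 + i * 16) + j
  else
    bif i.ble k then (j * 256 + i * 16) + k
    else bif j.ble k then (j * 256 + k * 16) + i else (k * 256 + j * 16) + i

theorem triples_perm : ∀ s ∈ live,
    ((triples s).map fun t => code t.1.cls t.2.1.cls t.2.2.cls).isPerm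
      ((coeffs s.cls).flatMap fun q =>
        List.replicate q.1 ((q.2.1 * 256 + q.2.2.1 * 16) + q.2.2.2)) := by
  decide +kernel

theorem St.beq_iff (s t : St) : s.beq t = true ↔ s = t := by
  obtain ⟨a, b, c, d, e, f⟩ := s
  obtain ⟨a', b', c', d', e', f'⟩ := t
  cases d <;> cases e <;> cases f <;> cases d' <;> cases e' <;> cases f' <;>
    simp [St.beq]

theorem code_decode (v : ℕ → ℕ) {i j k : ℕ} (hi : i < 16) (hj : j < 16) (hk : k < 16) :
    v (code i j k / 256) * v (code i j k / 16 % 16) * v (code i j k % 16) = v i * v j * v k := by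
  have key : ∀ a b c : ℕ, a < 16 → b < 16 → c < 16 →
      ((a * 256 + b * 16) + c) / 256 = a ∧ ((a * 256 + b * 16) + c) / 16 % 16 = b ∧
      ((a * 256 + b * 16) + c) % 16 = c := by omega
  unfold code
  rcases Bool.eq_false_or_eq_true (i.ble j) with h1 | h1 <;>
  rcases Bool.eq_false_or_eq_true (j.ble k) with h2 | h2 <;>
  rcases Bool.eq_false_or_eq_true (i.ble k) with h3 | h3 <;>
  simp only [h1, h2, h3, cond_true, cond_false] <;>
  first
  | (obtain ⟨e1, e2, e3⟩ := key i j k hi hj hk; rw [e1, e2, e3])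
  | (obtain ⟨e1, e2, e3⟩ := key i k j hi hk hj; rw [e1, e2, e3]; ring)
  | (obtain ⟨e1, e2, e3⟩ := key j i k hj hi hk; rw [e1, e2, e3]; ring)
  | (obtain ⟨e1, e2, e3⟩ := key j k i hj hk hi; rw [e1, e2, e3]; ring)
  | (obtain ⟨e1, e2, e3⟩ := key k i j hk hi hj; rw [e1, e2, e3]; ring)
  | (obtain ⟨e1, e2, e3⟩ := key k j i hk hj hi; rw [e1, e2, e3]; ring)

theorem states_nodup : states.Nodup := by decide +kernel

theorem states_weight : ∀ s ∈ states, 6 ≤ s.weight ∧ s.weight ≤ 8 := by decide +kernel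

theorem mem_live {s : St} : s ∈ live ↔ s ∈ states ∧ s.cls ≤ 9 := by
  simp [live]

theorem coeffs_le : ∀ c ≤ 9, ∀ q ∈ coeffs c, q.2.1 ≤ 9 ∧ q.2.2.1 ≤ 9 ∧ q.2.2.2 ≤ 9 := by
  decide +kernel

theorem states_cls_le : ∀ s ∈ states, s.cls ≤ 10 := by decide +kernel

theorem glueOK_iff {A B C : St} : glueOK A B C = true ↔
    A.d1 + B.d0 ≤ 2 ∧ A.d2 + C.d0 ≤ 2 ∧ B.d2 + C.d1 ≤ 2 ∧ outer A B C 3 = true ∧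
    outer A B C 4 = true ∧ outer A B C 5 = true ∧
    (glueSt A B C).classes + 3 = A.classes + B.classes + C.classes := by
  simp only [glueOK, Bool.and_eq_true, Nat.ble_eq, Nat.beq_eq]

theorem weight_glueSt {A B C : St} (h : glueOK A B C = true) :
    (glueSt A B C).weight + 6 + (A.d1 + B.d0) + (A.d2 + C.d0) + (B.d2 + C.d1) =
      A.weight + B.weight + C.weight := by
  rw [glueOK_iff] at h
  simp only [St.weight, St.degs] at *
  have : (glueSt A B C).d0 = A.d0 := rfl
  have : (glueSt A B C).d1 = B.d1 := rfl
  have : (glueSt A B C).d2 = C.d2 := rfl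
  omega

theorem mem_triples {s : St} {t : St × St × St} : t ∈ triples s ↔
    t.1 ∈ states ∧ t.2.1 ∈ states ∧ t.2.2 ∈ states ∧ glueOK t.1 t.2.1 t.2.2 = true ∧
      glueSt t.1 t.2.1 t.2.2 = s := by
  obtain ⟨A, B, C⟩ := t
  simp only [triples, List.mem_flatMap, List.mem_map, List.mem_filter, Bool.and_eq_true,
    Nat.beq_eq, Nat.ble_eq, St.beq_iff, Prod.mk.injEq]
  constructor
  · rintro ⟨A', ⟨hA, -⟩, B', ⟨hB, -⟩, C', ⟨hC, -, -, h1, h2⟩, rfl, rfl, rfl⟩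
    exact ⟨hA, hB, hC, h2, h1⟩
  · rintro ⟨hA, hB, hC, h2, rfl⟩
    have hw := weight_glueSt h2
    have h3 := glueOK_iff.1 h2
    have := states_weight A hA
    have := states_weight B hB
    have := states_weight C hC
    refine ⟨A, ⟨hA, rfl, by omega⟩, B, ⟨hB, rfl, by omega, by omega⟩, C,
      ⟨hC, rfl, by omega, rfl, h2⟩, rfl, rfl, rfl⟩

theorem triples_nodup (s : St) : (triples s).Nodup := by
  unfold triples
  rw [List.nodup_flatMap]
  refine ⟨fun A _ => ?_, ?_⟩
  · rw [List.nodup_flatMap]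
    refine ⟨fun B _ => ?_, ?_⟩
    · exact (states_nodup.filter _).map fun C C' h => by simpa using h
    · refine (states_nodup.filter _).imp fun {B B'} h => ?_
      simp only [Function.onFun, List.disjoint_left, List.mem_map]
      rintro t ⟨C, -, rfl⟩ ⟨C', -, h'⟩
      simp only [Prod.mk.injEq] at h'
      exact h h'.2.1.symm
  · refine (states_nodup.filter _).imp fun {A A'} h => ?_
    simp only [Function.onFun, List.disjoint_left, List.mem_map, List.mem_flatMap]
    rintro t ⟨B, -, C, -, rfl⟩ ⟨B', -, C', -, h'⟩
    simp only [Prod.mk.injEq] at h'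
    exact h h'.1.symm

theorem triples_cls_le {s : St} (hs : s ∈ live) {t : St × St × St} (ht : t ∈ triples s) :
    t.1.cls ≤ 9 ∧ t.2.1.cls ≤ 9 ∧ t.2.2.cls ≤ 9 := by
  have hp := List.isPerm_iff.1 (triples_perm s hs)
  have hm := (hp.mem_iff (a := code t.1.cls t.2.1.cls t.2.2.cls)).1 (List.mem_map_of_mem ht)
  simp only [List.mem_flatMap, List.mem_replicate] at hm
  obtain ⟨q, hq, -, he⟩ := hm
  have hq' := coeffs_le _ (mem_live.1 hs).2 q hq
  obtain ⟨hA, hB, hC, -⟩ := mem_triples.1 ht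
  have h1 := states_cls_le _ hA
  have h2 := states_cls_le _ hB
  have h3 := states_cls_le _ hC
  have := code_decode (fun x => if x ≤ 9 then 1 else 0) (i := t.1.cls) (j := t.2.1.cls)
    (k := t.2.2.cls) (by omega) (by omega) (by omega)
  rw [he] at this
  rw [if_pos (by omega), if_pos (by omega), if_pos (by omega)] at this
  by_contra hcon
  by_cases g1 : t.1.cls ≤ 9 <;> by_cases g2 : t.2.1.cls ≤ 9 <;> by_cases g3 : t.2.2.cls ≤ 9 <;>
    simp_all

theorem sum_triples (v : ℕ → ℕ) {s : St} (hs : s ∈ live) :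
    ((triples s).map fun t => v t.1.cls * v t.2.1.cls * v t.2.2.cls).sum =
      ((coeffs s.cls).map fun q => q.1 * (v q.2.1 * v q.2.2.1 * v q.2.2.2)).sum := by
  have hp := List.isPerm_iff.1 (triples_perm s hs)
  have h := (hp.map fun x => v (x / 256) * v (x / 16 % 16) * v (x % 16)).sum_eq
  rw [List.map_map] at h
  have h1 : ∀ t ∈ triples s, ((fun x => v (x / 256) * v (x / 16 % 16) * v (x % 16)) ∘
      fun t : St × St × St => code t.1.cls t.2.1.cls t.2.2.cls) t =
      v t.1.cls * v t.2.1.cls * v t.2.2.cls := by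
    intro t ht
    have := triples_cls_le hs ht
    exact code_decode v (by omega) (by omega) (by omega)
  rw [List.map_congr_left h1] at h
  rw [h, List.map_flatMap, List.flatMap_def, List.sum_flatten, List.map_map]
  congr 1
  refine List.map_congr_left fun q hq => ?_
  have hq' := coeffs_le _ (mem_live.1 hs).2 q hq
  rw [Function.comp_apply, List.map_replicate, List.sum_replicate, smul_eq_mul]
  congr 4 <;> omega

section Boundary

variable {P : Type*}

/-- `x` and `y` are connected by edges of `S` -/
def Conn (S : Finset (Sym2 P)) (x y : P) : Prop :=
  (SimpleGraph.fromEdgeSet (S : Set (Sym2 P))).Reachable x y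

theorem Conn.refl (S : Finset (Sym2 P)) (x : P) : Conn S x x := SimpleGraph.Reachable.refl x

theorem Conn.symm {S : Finset (Sym2 P)} {x y : P} (h : Conn S x y) : Conn S y x :=
  SimpleGraph.Reachable.symm h

theorem Conn.trans {S : Finset (Sym2 P)} {x y z : P} (h : Conn S x y) (h' : Conn S y z) :
    Conn S x z := SimpleGraph.Reachable.trans h h'

theorem Conn.mono {S S' : Finset (Sym2 P)} (hS : S ⊆ S') {x y : P} (h : Conn S x y) :
    Conn S' x y :=
  SimpleGraph.Reachable.mono (SimpleGraph.fromEdgeSet_mono (Finset.coe_subset.2 hS)) h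

theorem Conn.of_mem {S : Finset (Sym2 P)} {x y : P} (h : s(x, y) ∈ S) : Conn S x y := by
  by_cases hxy : x = y
  · subst hxy
    exact Conn.refl S x
  · exact SimpleGraph.Adj.reachable ((SimpleGraph.fromEdgeSet_adj _).2 ⟨h, hxy⟩)

theorem Conn.induction {S : Finset (Sym2 P)} {x : P} {Q : P → Prop} (h0 : Q x)
    (hs : ∀ z z', s(z, z') ∈ S → Q z → Q z') {y : P} (h : Conn S x y) : Q y := by
  rw [Conn, SimpleGraph.reachable_iff_reflTransGen] at h
  induction h with
  | refl => exact h0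
  | tail _ h2 ih => exact hs _ _ ((SimpleGraph.fromEdgeSet_adj _).1 h2).1 ih

/-- number of edges of `S` at `x` -/
def deg (S : Finset (Sym2 P)) (x : P) : ℕ := (S.filter (x ∈ ·)).card

/-- boundary state of the edge set `S` with respect to the three outmost vertices `t` -/
def stateOf (t : Fin 3 → P) (S : Finset (Sym2 P)) : St where
  d0 := deg S (t 0)
  d1 := deg S (t 1)
  d2 := deg S (t 2)
  c01 := decide (Conn S (t 0) (t 1))
  c02 := decide (Conn S (t 0) (t 2))
  c12 := decide (Conn S (t 1) (t 2))

/-- every vertex is connected to an outmost vertex -/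
def Reach (V : Finset P) (t : Fin 3 → P) (S : Finset (Sym2 P)) : Prop :=
  ∀ x ∈ V, ∃ i, Conn S x (t i)

/-- `S` is a union of paths covering `V`, each component of which meets the outmost vertices -/
structure Good (V : Finset P) (t : Fin 3 → P) (S : Finset (Sym2 P)) : Prop where
  reach : Reach V t S
  deg_le : ∀ x ∈ V, deg S x ≤ 2
  card_add : S.card + (stateOf t S).classes = V.card

/-- a finite graph with three distinguished vertices -/
structure Piece (V : Finset P) (t : Fin 3 → P) (E : Finset (Sym2 P)) : Prop where
  tmem : ∀ i, t i ∈ V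
  tinj : Function.Injective t
  emem : ∀ e ∈ E, ∀ x ∈ e, x ∈ V
  ediag : ∀ e ∈ E, ¬ e.IsDiag
  excess : ∀ S ⊆ E, Reach V t S → V.card ≤ S.card + (stateOf t S).classes

theorem sum_deg {V : Finset P} {S : Finset (Sym2 P)} (hV : ∀ e ∈ S, ∀ x ∈ e, x ∈ V)
    (hd : ∀ e ∈ S, ¬ e.IsDiag) : ∑ x ∈ V, deg S x = 2 * S.card := by
  have h := Finset.sum_card_bipartiteAbove_eq_sum_card_bipartiteBelow
    (fun (x : P) (e : Sym2 P) => x ∈ e) (s := V) (t := S)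
  simp only [Finset.bipartiteAbove, Finset.bipartiteBelow] at h
  unfold deg
  rw [h, Finset.sum_const_nat (m := 2), mul_comm]
  intro e he
  induction e with
  | _ p q =>
    have hpq : p ≠ q := fun h => hd _ he (by simpa using h)
    have : V.filter (· ∈ s(p, q)) = {p, q} := by
      ext z
      simp only [Finset.mem_filter, Sym2.mem_iff, Finset.mem_insert, Finset.mem_singleton]
      constructor
      · exact fun h => h.2
      · rintro (rfl | rfl)
        · exact ⟨hV _ he _ (by simp), Or.inl rfl⟩
        · exact ⟨hV _ he _ (by simp), Or.inr rfl⟩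
    rw [this, Finset.card_pair hpq]

theorem Piece.weight_ge {V : Finset P} {t : Fin 3 → P} {E : Finset (Sym2 P)} (hp : Piece V t E)
    {S : Finset (Sym2 P)} (hS : S ⊆ E) (hg : Good V t S) : 6 ≤ (stateOf t S).weight := by
  have h := sum_deg (V := V) (S := S) (fun e he => hp.emem e (hS he))
    (fun e he => hp.ediag e (hS he))
  have hsub : Finset.univ.image t ⊆ V := by
    intro z hz
    obtain ⟨i, -, rfl⟩ := Finset.mem_image.1 hz
    exact hp.tmem i
  rw [← Finset.sum_sdiff hsub, Finset.sum_image (fun _ _ _ _ h => hp.tinj h)] at h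
  have hc : (Finset.univ.image t).card = 3 := by
    rw [Finset.card_image_of_injective _ hp.tinj]
    simp
  have hle : ∑ z ∈ V \ Finset.univ.image t, deg S z ≤ (V \ Finset.univ.image t).card * 2 :=
    Finset.sum_le_card_nsmul _ _ _ fun z hz => hg.deg_le z (Finset.mem_sdiff.1 hz).1
  have h3 := Finset.card_sdiff_add_card_eq_card hsub
  have h4 := hg.card_add
  simp only [Fin.sum_univ_three] at h
  simp only [St.weight, St.degs]
  have : (stateOf t S).d0 = deg S (t 0) := rfl
  have : (stateOf t S).d1 = deg S (t 1) := rfl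
  have : (stateOf t S).d2 = deg S (t 2) := rfl
  omega

theorem deg_pos {S : Finset (Sym2 P)} {x y : P} (hxy : x ≠ y)
    (h : Conn S x y) : 0 < deg S x := by
  by_contra h0
  have h1 : deg S x = 0 := by omega
  refine hxy (Conn.induction (Q := fun z => x = z) rfl ?_ h)
  rintro z z' he rfl
  exfalso
  rw [deg, Finset.card_eq_zero, Finset.filter_eq_empty_iff] at h1
  exact h1 he (by simp)

theorem mem_states_of {s : St} (h0 : s.d0 ≤ 2) (h1 : s.d1 ≤ 2) (h2 : s.d2 ≤ 2)
    (hw : 6 ≤ s.weight) (hw' : s.weight ≤ 8)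
    (t1 : s.c01 = true → s.c02 = true → s.c12 = true)
    (t2 : s.c01 = true → s.c12 = true → s.c02 = true)
    (t3 : s.c02 = true → s.c12 = true → s.c01 = true)
    (p01 : s.c01 = true → 0 < s.d0 ∧ 0 < s.d1) (p02 : s.c02 = true → 0 < s.d0 ∧ 0 < s.d2)
    (p12 : s.c12 = true → 0 < s.d1 ∧ 0 < s.d2) : s ∈ states := by
  obtain ⟨d0, d1, d2, c01, c02, c12⟩ := s
  have key : ∀ (d0 d1 d2 : Fin 3) (c01 c02 c12 : Bool),
      (!(Nat.ble 6 (St.mk d0 d1 d2 c01 c02 c12).weight &&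
        (Nat.ble (St.mk d0 d1 d2 c01 c02 c12).weight 8 &&
        ((!c01 || !c02 || c12) && (!c01 || !c12 || c02) && (!c02 || !c12 || c01) &&
        ((!c01 || (Nat.ble 1 d0 && Nat.ble 1 d1)) && (!c02 || (Nat.ble 1 d0 && Nat.ble 1 d2)) &&
        (!c12 || (Nat.ble 1 d1 && Nat.ble 1 d2)))))) ||
      states.any ((St.mk d0 d1 d2 c01 c02 c12).beq ·)) = true := by decide +kernel
  have h := key ⟨d0, Nat.lt_succ_of_le h0⟩ ⟨d1, Nat.lt_succ_of_le h1⟩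
    ⟨d2, Nat.lt_succ_of_le h2⟩ c01 c02 c12
  rw [Bool.or_eq_true, List.any_eq_true] at h
  rcases h with h | ⟨s, hs, h⟩
  · exfalso
    revert h
    simp only [Bool.not_eq_true', ← Bool.not_eq_true, Bool.and_eq_true, Nat.ble_eq]
    refine not_not.2 ⟨hw, hw', ?_⟩
    cases c01 <;> cases c02 <;> cases c12 <;> simp_all <;> omega
  · rw [St.beq_iff] at h
    rwa [h]

theorem stateOf_trans (t : Fin 3 → P) (S : Finset (Sym2 P)) :
    ((stateOf t S).c01 = true → (stateOf t S).c02 = true → (stateOf t S).c12 = true) ∧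
    ((stateOf t S).c01 = true → (stateOf t S).c12 = true → (stateOf t S).c02 = true) ∧
    ((stateOf t S).c02 = true → (stateOf t S).c12 = true → (stateOf t S).c01 = true) := by
  simp only [stateOf, decide_eq_true_eq]
  exact ⟨fun h h' => h.symm.trans h', fun h h' => h.trans h', fun h h' => h.trans h'.symm⟩

theorem Piece.mem_states {V : Finset P} {t : Fin 3 → P} {E : Finset (Sym2 P)} (hp : Piece V t E)
    {S : Finset (Sym2 P)} (hS : S ⊆ E) (hg : Good V t S) (hw : (stateOf t S).weight ≤ 8) :
    stateOf t S ∈ states := by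
  obtain ⟨t1, t2, t3⟩ := stateOf_trans t S
  have hne : ∀ i j : Fin 3, i ≠ j → Conn S (t i) (t j) → 0 < deg S (t i) ∧ 0 < deg S (t j) :=
    fun i j hij h => ⟨deg_pos (hp.tinj.ne hij) h, deg_pos (hp.tinj.ne hij.symm) h.symm⟩
  refine mem_states_of (hg.deg_le _ (hp.tmem 0)) (hg.deg_le _ (hp.tmem 1))
    (hg.deg_le _ (hp.tmem 2)) (hp.weight_ge hS hg) hw t1 t2 t3 ?_ ?_ ?_
  · intro h
    exact hne 0 1 (by decide) (by simpa [stateOf] using h)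
  · intro h
    exact hne 0 2 (by decide) (by simpa [stateOf] using h)
  · intro h
    exact hne 1 2 (by decide) (by simpa [stateOf] using h)

end Boundary

theorem merge_mono {t : Bool} {i j : Fin 6} {l : Fin 6 → ℕ} {a b : Fin 6} (h : l a = l b) :
    merge t i j l a = merge t i j l b := by
  cases t <;> simp [merge, h]

theorem merge_join {t : Bool} {i j : Fin 6} {l : Fin 6 → ℕ} (h : t = true) :
    merge t i j l i = merge t i j l j := by
  subst h
  simp only [merge, cond_true, Nat.beq_refl]
  cases Nat.beq (l j) (l i) <;> rfl

theorem merge_sound {R : Fin 6 → Fin 6 → Prop} (hR : Equivalence R) {t : Bool} {i j : Fin 6}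
    (ht : t = true → R i j) {l : Fin 6 → ℕ} (hl : ∀ a b, l a = l b → R a b) :
    ∀ a b, merge t i j l a = merge t i j l b → R a b := by
  cases t with
  | false => exact hl
  | true =>
    have hij := ht rfl
    intro a b h
    simp only [merge, cond_true] at h
    rcases Bool.eq_false_or_eq_true (Nat.beq (l a) (l i)) with ha | ha <;>
    rcases Bool.eq_false_or_eq_true (Nat.beq (l b) (l i)) with hb | hb <;>
    simp only [ha, hb, cond_true, cond_false] at h <;>
    simp only [Nat.beq_eq, ← Bool.not_eq_true] at ha hb
    · exact hl a b (ha.trans hb.symm)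
    · exact hR.trans (hl a i ha) (hR.trans hij (hl j b h))
    · exact hR.trans (hl a j h) (hR.trans (hR.symm hij) (hl i b hb.symm))
    · exact hl a b h

theorem glueLabel_sound {R : Fin 6 → Fin 6 → Prop} (hR : Equivalence R) {A B C : St}
    (a01 : A.c01 = true → R 0 3) (a02 : A.c02 = true → R 0 4) (a12 : A.c12 = true → R 3 4)
    (b01 : B.c01 = true → R 3 1) (b02 : B.c02 = true → R 3 5) (b12 : B.c12 = true → R 1 5)
    (c01 : C.c01 = true → R 4 5) (c02 : C.c02 = true → R 4 2) (c12 : C.c12 = true → R 5 2)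
    {i j : Fin 6} (h : glueLabel A B C i = glueLabel A B C j) : R i j := by
  refine merge_sound hR c12 (merge_sound hR c02 (merge_sound hR c01 (merge_sound hR b12
    (merge_sound hR b02 (merge_sound hR b01 (merge_sound hR a12 (merge_sound hR a02
    (merge_sound hR a01 ?_)))))))) i j h
  intro a b hab
  rw [Fin.ext hab]
  exact hR.refl b

/-- `idx i l` is the index of the `l`-th outmost vertex of the `i`-th copy -/
def idx : Fin 3 → Fin 3 → Fin 6 := ![![0, 3, 4], ![3, 1, 5], ![4, 5, 2]]

theorem glueLabel_complete (s : Fin 3 → St) :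
    ((s 0).c01 = true → glueLabel (s 0) (s 1) (s 2) 0 = glueLabel (s 0) (s 1) (s 2) 3) ∧
    ((s 0).c02 = true → glueLabel (s 0) (s 1) (s 2) 0 = glueLabel (s 0) (s 1) (s 2) 4) ∧
    ((s 0).c12 = true → glueLabel (s 0) (s 1) (s 2) 3 = glueLabel (s 0) (s 1) (s 2) 4) ∧
    ((s 1).c01 = true → glueLabel (s 0) (s 1) (s 2) 3 = glueLabel (s 0) (s 1) (s 2) 1) ∧
    ((s 1).c02 = true → glueLabel (s 0) (s 1) (s 2) 3 = glueLabel (s 0) (s 1) (s 2) 5) ∧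
    ((s 1).c12 = true → glueLabel (s 0) (s 1) (s 2) 1 = glueLabel (s 0) (s 1) (s 2) 5) ∧
    ((s 2).c01 = true → glueLabel (s 0) (s 1) (s 2) 4 = glueLabel (s 0) (s 1) (s 2) 5) ∧
    ((s 2).c02 = true → glueLabel (s 0) (s 1) (s 2) 4 = glueLabel (s 0) (s 1) (s 2) 2) ∧
    ((s 2).c12 = true → glueLabel (s 0) (s 1) (s 2) 5 = glueLabel (s 0) (s 1) (s 2) 2) := by
  refine ⟨?_, ?_, ?_, ?_, ?_, ?_, ?_, ?_, ?_⟩ <;> intro h <;> unfold glueLabel <;>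
    first
    | exact merge_join h
    | exact merge_mono (merge_join h)
    | exact merge_mono (merge_mono (merge_join h))
    | exact merge_mono (merge_mono (merge_mono (merge_join h)))
    | exact merge_mono (merge_mono (merge_mono (merge_mono (merge_join h))))
    | exact merge_mono (merge_mono (merge_mono (merge_mono (merge_mono (merge_join h)))))
    | exact merge_mono (merge_mono (merge_mono (merge_mono (merge_mono (merge_mono
        (merge_join h))))))
    | exact merge_mono (merge_mono (merge_mono (merge_mono (merge_mono (merge_mono (merge_mono
        (merge_join h)))))))
    | exact merge_mono (merge_mono (merge_mono (merge_mono (merge_mono (merge_mono (merge_mono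
        (merge_mono (merge_join h))))))))

/-- the connectivity data is a transitive relation -/
def St.valid (s : St) : Bool :=
  (!s.c01 || !s.c02 || s.c12) && ((!s.c01 || !s.c12 || s.c02) && (!s.c02 || !s.c12 || s.c01))

theorem outer_classes {A B C : St} (hA : A.valid = true) (hB : B.valid = true)
    (hC : C.valid = true) (h3 : outer A B C 3 = true) (h4 : outer A B C 4 = true)
    (h5 : outer A B C 5 = true) :
    A.classes + B.classes + C.classes ≤ (glueSt A B C).classes + 3 := by
  obtain ⟨_, _, _, a1, a2, a3⟩ := A
  obtain ⟨_, _, _, b1, b2, b3⟩ := B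
  obtain ⟨_, _, _, c1, c2, c3⟩ := C
  have key : ∀ a1 a2 a3 b1 b2 b3 c1 c2 c3 : Bool,
      (St.mk 0 0 0 a1 a2 a3).valid = true → (St.mk 0 0 0 b1 b2 b3).valid = true →
      (St.mk 0 0 0 c1 c2 c3).valid = true →
      outer ⟨0, 0, 0, a1, a2, a3⟩ ⟨0, 0, 0, b1, b2, b3⟩ ⟨0, 0, 0, c1, c2, c3⟩ 3 = true →
      outer ⟨0, 0, 0, a1, a2, a3⟩ ⟨0, 0, 0, b1, b2, b3⟩ ⟨0, 0, 0, c1, c2, c3⟩ 4 = true →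
      outer ⟨0, 0, 0, a1, a2, a3⟩ ⟨0, 0, 0, b1, b2, b3⟩ ⟨0, 0, 0, c1, c2, c3⟩ 5 = true →
      ((St.mk 0 0 0 a1 a2 a3).classes + (St.mk 0 0 0 b1 b2 b3).classes +
        (St.mk 0 0 0 c1 c2 c3).classes).ble
        ((glueSt ⟨0, 0, 0, a1, a2, a3⟩ ⟨0, 0, 0, b1, b2, b3⟩ ⟨0, 0, 0, c1, c2, c3⟩).classes
          + 3) = true := by decide +kernel
  exact Nat.le_of_ble_eq_true (key a1 a2 a3 b1 b2 b3 c1 c2 c3 hA hB hC h3 h4 h5)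

section Gluing

variable {P : Type*}

/-- three vertex sets glued along the corner vertices `x` as in the Sierpinski gasket -/
structure Gluing (V : Fin 3 → Finset P) (x : Fin 6 → P) : Prop where
  inj : Function.Injective x
  mem_iff : ∀ i b, x b ∈ V i ↔ ∃ l, b = idx i l
  inter : ∀ i j, i ≠ j → ∀ v, v ∈ V i → v ∈ V j → ∃ b, v = x b

/-- three edge sets supported on the respective vertex sets -/
structure EdgeFam (V : Fin 3 → Finset P) (S : Fin 3 → Finset (Sym2 P)) : Prop where
  emem : ∀ i, ∀ e ∈ S i, ∀ v ∈ e, v ∈ V i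
  ediag : ∀ i, ∀ e ∈ S i, ¬ e.IsDiag

/-- union of three finite sets -/
def union {α : Type*} (S : Fin 3 → Finset α) : Finset α := Finset.univ.biUnion S

theorem mem_union {α : Type*} {S : Fin 3 → Finset α} {e : α} : e ∈ union S ↔ ∃ i, e ∈ S i := by
  simp [union]

theorem subset_union {α : Type*} (S : Fin 3 → Finset α) (i : Fin 3) : S i ⊆ union S :=
  Finset.subset_biUnion_of_mem S (Finset.mem_univ i)

theorem card_union_of_disjoint {α : Type*} {S : Fin 3 → Finset α}
    (h : ∀ i j, i ≠ j → Disjoint (S i) (S j)) :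
    (union S).card = (S 0).card + (S 1).card + (S 2).card := by
  rw [← Fin.sum_univ_three fun i => (S i).card]
  exact Finset.card_biUnion fun i _ j _ hij => h i j hij

theorem filter_union {α : Type*} (S : Fin 3 → Finset α) (p : α → Prop)
    [DecidablePred p] : (union S).filter p = union fun i => (S i).filter p := by
  ext e
  simp [mem_union]

variable {V : Fin 3 → Finset P} {x : Fin 6 → P} {S : Fin 3 → Finset (Sym2 P)}

theorem Gluing.corner_mem (hG : Gluing V x) (i l : Fin 3) : x (idx i l) ∈ V i :=
  (hG.mem_iff i _).2 ⟨l, rfl⟩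

theorem Gluing.conn_imp (hG : Gluing V x) (hS : EdgeFam V S) {R : Fin 6 → Fin 6 → Prop}
    (hR : Equivalence R)
    (h : ∀ i k l, Conn (S i) (x (idx i k)) (x (idx i l)) → R (idx i k) (idx i l))
    {p q : Fin 6} (hpq : Conn (union S) (x p) (x q)) : R p q := by
  have hcov : ∀ p : Fin 6, ∃ i l, p = idx i l := by decide
  have hQ : ∃ i k, x q ∈ V i ∧ Conn (S i) (x (idx i k)) (x q) ∧ R p (idx i k) := by
    refine Conn.induction (Q := fun z => ∃ i k, z ∈ V i ∧ Conn (S i) (x (idx i k)) z ∧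
      R p (idx i k)) ?_ ?_ hpq
    · obtain ⟨i, l, rfl⟩ := hcov p
      exact ⟨i, l, hG.corner_mem i l, Conn.refl _ _, hR.refl _⟩
    · rintro z z' he ⟨i, k, hz, hc, hr⟩
      obtain ⟨j, hj⟩ := mem_union.1 he
      have hzj := hS.emem j _ hj z (by simp)
      have hzj' := hS.emem j _ hj z' (by simp)
      by_cases hij : i = j
      · subst hij
        exact ⟨i, k, hzj', hc.trans (Conn.of_mem hj), hr⟩
      · obtain ⟨b, rfl⟩ := hG.inter i j hij z hz hzj
        obtain ⟨l, hl⟩ := (hG.mem_iff i b).1 hz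
        obtain ⟨l', hl'⟩ := (hG.mem_iff j b).1 hzj
        refine ⟨j, l', hzj', ?_, ?_⟩
        · rw [← hl']
          exact Conn.of_mem hj
        · rw [← hl', hl]
          refine hR.trans hr (h i k l ?_)
          rw [← hl]
          exact hc
  obtain ⟨i, k, hq, hc, hr⟩ := hQ
  obtain ⟨l, rfl⟩ := (hG.mem_iff i q).1 hq
  exact hR.trans hr (h i k l hc)

/-- boundary states of the three copies -/
def parts (x : Fin 6 → P) (S : Fin 3 → Finset (Sym2 P)) (i : Fin 3) : St :=
  stateOf (x ∘ idx i) (S i)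

/-- the outmost vertices of the glued graph -/
def ends (x : Fin 6 → P) : Fin 3 → P := ![x 0, x 1, x 2]

theorem Gluing.conn_iff (hG : Gluing V x) (hS : EdgeFam V S) (p q : Fin 6) :
    Conn (union S) (x p) (x q) ↔ glueLabel (parts x S 0) (parts x S 1) (parts x S 2) p =
      glueLabel (parts x S 0) (parts x S 1) (parts x S 2) q := by
  constructor
  · refine hG.conn_imp hS (R := fun p q => glueLabel (parts x S 0) (parts x S 1) (parts x S 2) p =
      glueLabel (parts x S 0) (parts x S 1) (parts x S 2) q) ⟨fun _ => rfl, Eq.symm, Eq.trans⟩ ?_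
    obtain ⟨h1, h2, h3, h4, h5, h6, h7, h8, h9⟩ := glueLabel_complete (parts x S)
    have key : ∀ i, ∀ R : Fin 3 → Fin 3 → Prop, Equivalence R →
        ((parts x S i).c01 = true → R 0 1) → ((parts x S i).c02 = true → R 0 2) →
        ((parts x S i).c12 = true → R 1 2) →
        ∀ k l, Conn (S i) (x (idx i k)) (x (idx i l)) → R k l := by
      intro i R hR r01 r02 r12 k l h
      have e01 : Conn (S i) (x (idx i 0)) (x (idx i 1)) → R 0 1 := fun h =>
        r01 (decide_eq_true h)
      have e02 : Conn (S i) (x (idx i 0)) (x (idx i 2)) → R 0 2 := fun h =>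
        r02 (decide_eq_true h)
      have e12 : Conn (S i) (x (idx i 1)) (x (idx i 2)) → R 1 2 := fun h =>
        r12 (decide_eq_true h)
      fin_cases k <;> fin_cases l
      · exact hR.refl _
      · exact e01 h
      · exact e02 h
      · exact hR.symm (e01 h.symm)
      · exact hR.refl _
      · exact e12 h
      · exact hR.symm (e02 h.symm)
      · exact hR.symm (e12 h.symm)
      · exact hR.refl _
    intro i
    refine key i (fun k l => _ = _) ⟨fun _ => rfl, Eq.symm, Eq.trans⟩ ?_ ?_ ?_
    · fin_cases i
      exacts [h1, h4, h7]
    · fin_cases i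
      exacts [h2, h5, h8]
    · fin_cases i
      exacts [h3, h6, h9]
  · have e : ∀ i k l, decide (Conn (S i) (x (idx i k)) (x (idx i l))) = true →
        Conn (union S) (x (idx i k)) (x (idx i l)) := fun i k l h =>
      (of_decide_eq_true h).mono (subset_union S i)
    exact glueLabel_sound (R := fun p q => Conn (union S) (x p) (x q))
      ⟨fun _ => Conn.refl _ _, Conn.symm, Conn.trans⟩ (e 0 0 1) (e 0 0 2) (e 0 1 2)
      (e 1 0 1) (e 1 0 2) (e 1 1 2) (e 2 0 1) (e 2 0 2) (e 2 1 2)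

theorem deg_eq_zero {S : Finset (Sym2 P)} {V : Finset P} (h : ∀ e ∈ S, ∀ v ∈ e, v ∈ V) {v : P}
    (hv : v ∉ V) : deg S v = 0 := by
  rw [deg, Finset.card_eq_zero, Finset.filter_eq_empty_iff]
  exact fun e he hve => hv (h e he v hve)

theorem Gluing.disjoint (hG : Gluing V x) (hS : EdgeFam V S) {i j : Fin 3} (hij : i ≠ j) :
    Disjoint (S i) (S j) := by
  rw [Finset.disjoint_left]
  intro e hi hj
  induction e with
  | _ p q =>
    have key : ∀ i j, i ≠ j → ∀ k l k' l', idx i k = idx j k' → idx i l = idx j l' →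
        idx i k = idx i l := by decide
    have hp := hS.emem i _ hi p (by simp)
    have hp' := hS.emem j _ hj p (by simp)
    have hq := hS.emem i _ hi q (by simp)
    have hq' := hS.emem j _ hj q (by simp)
    obtain ⟨b, rfl⟩ := hG.inter i j hij p hp hp'
    obtain ⟨b', rfl⟩ := hG.inter i j hij q hq hq'
    obtain ⟨k, hk⟩ := (hG.mem_iff i b).1 hp
    obtain ⟨k', hk'⟩ := (hG.mem_iff j b).1 hp'
    obtain ⟨l, hl⟩ := (hG.mem_iff i b').1 hq
    obtain ⟨l', hl'⟩ := (hG.mem_iff j b').1 hq'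
    have : b = b' := by
      rw [hk, hl]
      exact key i j hij k l k' l' (hk.symm.trans hk') (hl.symm.trans hl')
    exact hS.ediag i _ hi (by simp [this])

theorem Gluing.card_union (hG : Gluing V x) (hS : EdgeFam V S) :
    (union S).card = (S 0).card + (S 1).card + (S 2).card := by
  exact card_union_of_disjoint fun i j hij => hG.disjoint hS hij

theorem Gluing.deg_union (hG : Gluing V x) (hS : EdgeFam V S) (v : P) :
    deg (union S) v = deg (S 0) v + deg (S 1) v + deg (S 2) v := by
  simp only [deg, filter_union]
  exact card_union_of_disjoint fun i j hij =>
    (hG.disjoint hS hij).mono (Finset.filter_subset _ _) (Finset.filter_subset _ _)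

theorem Gluing.deg_corner (hG : Gluing V x) (hS : EdgeFam V S) :
    deg (union S) (x 0) = (parts x S 0).d0 ∧ deg (union S) (x 1) = (parts x S 1).d1 ∧
    deg (union S) (x 2) = (parts x S 2).d2 ∧
    deg (union S) (x 3) = (parts x S 0).d1 + (parts x S 1).d0 ∧
    deg (union S) (x 4) = (parts x S 0).d2 + (parts x S 2).d0 ∧
    deg (union S) (x 5) = (parts x S 1).d2 + (parts x S 2).d1 := by
  have z : ∀ i b, (∀ l, b ≠ idx i l) → deg (S i) (x b) = 0 := fun i b h =>
    deg_eq_zero (hS.emem i) fun hb => by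
      obtain ⟨l, hl⟩ := (hG.mem_iff i b).1 hb
      exact h l hl
  refine ⟨?_, ?_, ?_, ?_, ?_, ?_⟩ <;> rw [hG.deg_union hS]
  · rw [z 1 0 (by decide), z 2 0 (by decide)]
    rfl
  · rw [z 0 1 (by decide), z 2 1 (by decide), zero_add]
    rfl
  · rw [z 0 2 (by decide), z 1 2 (by decide), zero_add, zero_add]
    rfl
  · rw [z 2 3 (by decide)]
    rfl
  · rw [z 1 4 (by decide)]
    rfl
  · rw [z 0 5 (by decide), zero_add]
    rfl

theorem Gluing.stateOf_union (hG : Gluing V x) (hS : EdgeFam V S) :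
    stateOf (ends x) (union S) = glueSt (parts x S 0) (parts x S 1) (parts x S 2) := by
  obtain ⟨h0, h1, h2, -⟩ := hG.deg_corner hS
  have hb : ∀ p q : Fin 6, decide (Conn (union S) (x p) (x q)) =
      (glueLabel (parts x S 0) (parts x S 1) (parts x S 2) p).beq
      (glueLabel (parts x S 0) (parts x S 1) (parts x S 2) q) := fun p q => by
    rw [Bool.eq_iff_iff, decide_eq_true_eq, Nat.beq_eq]
    exact hG.conn_iff hS p q
  simp only [stateOf, ends, glueSt, St.mk.injEq]
  exact ⟨h0, h1, h2, hb 0 1, hb 0 2, hb 1 2⟩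

theorem Gluing.outer_iff (hG : Gluing V x) (hS : EdgeFam V S) (p : Fin 6) :
    outer (parts x S 0) (parts x S 1) (parts x S 2) p = true ↔
      ∃ i, Conn (union S) (x p) (ends x i) := by
  simp only [outer, Bool.or_eq_true, Nat.beq_eq, ← hG.conn_iff hS]
  constructor
  · rintro (h | h | h)
    exacts [⟨0, h⟩, ⟨1, h⟩, ⟨2, h⟩]
  · rintro ⟨i, h⟩
    fin_cases i
    exacts [Or.inl h, Or.inr (Or.inl h), Or.inr (Or.inr h)]

theorem Gluing.reach_iff (hG : Gluing V x) (hS : EdgeFam V S) :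
    Reach (union V) (ends x) (union S) ↔ (∀ i, Reach (V i) (x ∘ idx i) (S i)) ∧
      outer (parts x S 0) (parts x S 1) (parts x S 2) 3 = true ∧
      outer (parts x S 0) (parts x S 1) (parts x S 2) 4 = true ∧
      outer (parts x S 0) (parts x S 1) (parts x S 2) 5 = true := by
  have hcov : ∀ p : Fin 6, ∃ i l, p = idx i l := by decide
  have hends : ∀ i, ∃ b, ends x i = x b := by
    intro i
    fin_cases i
    exacts [⟨0, rfl⟩, ⟨1, rfl⟩, ⟨2, rfl⟩]
  constructor
  · intro h
    have hout : ∀ p, outer (parts x S 0) (parts x S 1) (parts x S 2) p = true := by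
      intro p
      rw [hG.outer_iff hS]
      obtain ⟨i, l, rfl⟩ := hcov p
      exact h _ (subset_union V i (hG.corner_mem i l))
    refine ⟨fun i v hv => ?_, hout 3, hout 4, hout 5⟩
    obtain ⟨k, hk⟩ := h v (subset_union V i hv)
    refine Conn.induction (Q := fun z => ∀ i, z ∈ V i → ∃ k, Conn (S i) z (x (idx i k)))
      ?_ ?_ hk.symm i hv
    · obtain ⟨b, hb⟩ := hends k
      rw [hb]
      intro i hi
      obtain ⟨l, rfl⟩ := (hG.mem_iff i b).1 hi
      exact ⟨l, Conn.refl _ _⟩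
    · intro z z' he hz i hz'
      obtain ⟨j, hj⟩ := mem_union.1 he
      by_cases hij : i = j
      · subst hij
        obtain ⟨k, hk⟩ := hz i (hS.emem i _ hj z (by simp))
        exact ⟨k, (Conn.of_mem hj).symm.trans hk⟩
      · obtain ⟨b, rfl⟩ := hG.inter i j hij z' hz' (hS.emem j _ hj z' (by simp))
        obtain ⟨l, rfl⟩ := (hG.mem_iff i b).1 hz'
        exact ⟨l, Conn.refl _ _⟩
  · rintro ⟨h, h3, h4, h5⟩ v hv
    obtain ⟨i, hi⟩ := mem_union.1 hv
    obtain ⟨k, hk⟩ := h i v hi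
    have hb : ∀ b : Fin 6, ∃ k, Conn (union S) (x b) (ends x k) := by
      intro b
      fin_cases b
      · exact ⟨0, Conn.refl _ _⟩
      · exact ⟨1, Conn.refl _ _⟩
      · exact ⟨2, Conn.refl _ _⟩
      · exact (hG.outer_iff hS 3).1 h3
      · exact (hG.outer_iff hS 4).1 h4
      · exact (hG.outer_iff hS 5).1 h5
    obtain ⟨k', hk'⟩ := hb (idx i k)
    exact ⟨k', (hk.mono (subset_union S i)).trans hk'⟩

theorem Gluing.card_vertices (hG : Gluing V x) :
    (union V).card + 3 = (V 0).card + (V 1).card + (V 2).card := by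
  have hu : union V = (V 0 ∪ V 1) ∪ V 2 := by
    ext v
    simp only [mem_union, Finset.mem_union, Fin.exists_fin_succ]
    simp [or_assoc]
  have hm : ∀ i b, x b ∈ V i ↔ b ∈ Finset.univ.image (idx i) := by
    intro i b
    rw [hG.mem_iff]
    simp [eq_comm]
  have h1 : V 0 ∩ V 1 = {x 3} := by
    ext v
    simp only [Finset.mem_inter, Finset.mem_singleton]
    constructor
    · rintro ⟨h0, h1⟩
      obtain ⟨b, rfl⟩ := hG.inter 0 1 (by decide) v h0 h1
      rw [hm] at h0 h1
      revert h0 h1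
      have : ∀ b : Fin 6, b ∈ Finset.univ.image (idx 0) → b ∈ Finset.univ.image (idx 1) →
        b = 3 := by decide
      intro h0 h1
      rw [this b h0 h1]
    · rintro rfl
      rw [hm, hm]
      decide
  have h2 : (V 0 ∪ V 1) ∩ V 2 = {x 4, x 5} := by
    ext v
    simp only [Finset.mem_inter, Finset.mem_union, Finset.mem_insert, Finset.mem_singleton]
    constructor
    · rintro ⟨h01, h2⟩
      have : ∃ b, v = x b := h01.elim (fun h => hG.inter 0 2 (by decide) v h h2)
        (fun h => hG.inter 1 2 (by decide) v h h2)
      obtain ⟨b, rfl⟩ := this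
      rw [hm, hm] at h01
      rw [hm] at h2
      have : ∀ b : Fin 6, b ∈ Finset.univ.image (idx 0) ∨ b ∈ Finset.univ.image (idx 1) →
        b ∈ Finset.univ.image (idx 2) → b = 4 ∨ b = 5 := by decide
      rcases this b h01 h2 with rfl | rfl
      exacts [Or.inl rfl, Or.inr rfl]
    · rintro (rfl | rfl) <;> rw [hm, hm, hm] <;> decide
  have e1 := Finset.card_union_add_card_inter (V 0) (V 1)
  have e2 := Finset.card_union_add_card_inter (V 0 ∪ V 1) (V 2)
  rw [h1, Finset.card_singleton] at e1
  rw [h2, Finset.card_pair (hG.inj.ne (by decide))] at e2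
  rw [hu]
  omega

theorem Gluing.deg_le_iff (hG : Gluing V x) (hS : EdgeFam V S) :
    (∀ v ∈ union V, deg (union S) v ≤ 2) ↔ (∀ i, ∀ v ∈ V i, deg (S i) v ≤ 2) ∧
      (parts x S 0).d1 + (parts x S 1).d0 ≤ 2 ∧ (parts x S 0).d2 + (parts x S 2).d0 ≤ 2 ∧
      (parts x S 1).d2 + (parts x S 2).d1 ≤ 2 := by
  obtain ⟨h0, h1, h2, h3, h4, h5⟩ := hG.deg_corner hS
  have hm : ∀ i l, x (idx i l) ∈ union V := fun i l => subset_union V i (hG.corner_mem i l)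
  constructor
  · intro h
    refine ⟨fun i v hv => ?_, ?_, ?_, ?_⟩
    · refine le_trans ?_ (h v (subset_union V i hv))
      exact Finset.card_le_card (Finset.filter_subset_filter _ (subset_union S i))
    · rw [← h3]
      exact h _ (hm 0 1)
    · rw [← h4]
      exact h _ (hm 0 2)
    · rw [← h5]
      exact h _ (hm 1 2)
  · rintro ⟨h, g3, g4, g5⟩ v hv
    obtain ⟨i, hi⟩ := mem_union.1 hv
    by_cases hx : ∃ b, v = x b
    · obtain ⟨b, rfl⟩ := hx
      fin_cases b
      · exact h0.trans_le (h 0 _ (hG.corner_mem 0 0))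
      · exact h1.trans_le (h 1 _ (hG.corner_mem 1 1))
      · exact h2.trans_le (h 2 _ (hG.corner_mem 2 2))
      · exact h3.trans_le g3
      · exact h4.trans_le g4
      · exact h5.trans_le g5
    · have hz : ∀ j, j ≠ i → deg (S j) v = 0 := fun j hj =>
        deg_eq_zero (hS.emem j) fun hvj => hx (hG.inter j i hj v hvj hi)
      have := h i v hi
      rw [hG.deg_union hS]
      fin_cases i
      · rw [hz 1 (by decide), hz 2 (by decide)]
        exact this
      · rw [hz 0 (by decide), hz 2 (by decide), zero_add]
        exact this
      · rw [hz 0 (by decide), hz 1 (by decide), zero_add, zero_add]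
        exact this

end Gluing

section Counting

variable {P : Type*} {V : Fin 3 → Finset P} {x : Fin 6 → P} {E S : Fin 3 → Finset (Sym2 P)}

theorem stateOf_valid (t : Fin 3 → P) (S : Finset (Sym2 P)) : (stateOf t S).valid = true := by
  obtain ⟨h1, h2, h3⟩ := stateOf_trans t S
  generalize stateOf t S = s at *
  obtain ⟨_, _, _, c01, c02, c12⟩ := s
  cases c01 <;> cases c02 <;> cases c12 <;> simp_all [St.valid]

theorem edgeFam_of_piece (hp : ∀ i, Piece (V i) (x ∘ idx i) (E i)) (hS : ∀ i, S i ⊆ E i) :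
    EdgeFam V S :=
  ⟨fun i e he => (hp i).emem e (hS i he), fun i e he => (hp i).ediag e (hS i he)⟩

theorem Gluing.card_parts_le (hG : Gluing V x) (hp : ∀ i, Piece (V i) (x ∘ idx i) (E i))
    (hS : ∀ i, S i ⊆ E i) (hr : Reach (union V) (ends x) (union S)) :
    (∀ i, (V i).card ≤ (S i).card + (parts x S i).classes) ∧
      (parts x S 0).classes + (parts x S 1).classes + (parts x S 2).classes ≤
        (glueSt (parts x S 0) (parts x S 1) (parts x S 2)).classes + 3 := by
  have hF := edgeFam_of_piece hp hS
  obtain ⟨hr', h3, h4, h5⟩ := (hG.reach_iff hF).1 hr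
  exact ⟨fun i => (hp i).excess _ (hS i) (hr' i), outer_classes (stateOf_valid _ _)
    (stateOf_valid _ _) (stateOf_valid _ _) h3 h4 h5⟩

theorem Gluing.good_union_iff (hG : Gluing V x) (hp : ∀ i, Piece (V i) (x ∘ idx i) (E i))
    (hS : ∀ i, S i ⊆ E i) : Good (union V) (ends x) (union S) ↔
      (∀ i, Good (V i) (x ∘ idx i) (S i)) ∧
        glueOK (parts x S 0) (parts x S 1) (parts x S 2) = true := by
  have hF := edgeFam_of_piece hp hS
  have hc := hG.card_union hF
  have hv := hG.card_vertices
  rw [glueOK_iff]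
  constructor
  · rintro ⟨hr, hd, hk⟩
    obtain ⟨hle, hcl⟩ := hG.card_parts_le hp hS hr
    obtain ⟨hr', h3, h4, h5⟩ := (hG.reach_iff hF).1 hr
    obtain ⟨hd', g3, g4, g5⟩ := (hG.deg_le_iff hF).1 hd
    rw [hG.stateOf_union hF] at hk
    have h0' := hle 0
    have h1' := hle 1
    have h2' := hle 2
    have heq : ∀ i, (S i).card + (parts x S i).classes = (V i).card := by
      intro i
      fin_cases i
      · change (S 0).card + (parts x S 0).classes = (V 0).card
        omega
      · change (S 1).card + (parts x S 1).classes = (V 1).card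
        omega
      · change (S 2).card + (parts x S 2).classes = (V 2).card
        omega
    have e0 := heq 0
    have e1 := heq 1
    have e2 := heq 2
    exact ⟨fun i => ⟨hr' i, hd' i, heq i⟩, g3, g4, g5, h3, h4, h5, by omega⟩
  · rintro ⟨hg, g3, g4, g5, h3, h4, h5, hk⟩
    have e0 : (S 0).card + (parts x S 0).classes = _ := (hg 0).card_add
    have e1 : (S 1).card + (parts x S 1).classes = _ := (hg 1).card_add
    have e2 : (S 2).card + (parts x S 2).classes = _ := (hg 2).card_add
    refine ⟨(hG.reach_iff hF).2 ⟨fun i => (hg i).reach, h3, h4, h5⟩,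
      (hG.deg_le_iff hF).2 ⟨fun i => (hg i).deg_le, g3, g4, g5⟩, ?_⟩
    rw [hG.stateOf_union hF]
    omega

/-- the parts of `S` in the members of the family `E` -/
def restrict {α : Type*} (E : Fin 3 → Finset α) (S : Finset α) (i : Fin 3) : Finset α :=
  S.filter (· ∈ E i)

theorem restrict_subset {α : Type*} (E : Fin 3 → Finset α) (S : Finset α) (i : Fin 3) :
    restrict E S i ⊆ E i := fun _ he => (Finset.mem_filter.1 he).2

theorem union_restrict {α : Type*} {E : Fin 3 → Finset α} {S : Finset α} (hS : S ⊆ union E) :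
    union (restrict E S) = S := by
  ext e
  simp only [mem_union, restrict, Finset.mem_filter, exists_and_left, and_iff_left_iff_imp]
  exact fun he => mem_union.1 (hS he)

theorem restrict_union {α : Type*} {E S : Fin 3 → Finset α}
    (hE : ∀ i j, i ≠ j → Disjoint (E i) (E j)) (hS : ∀ i, S i ⊆ E i) :
    restrict E (union S) = S := by
  funext i
  ext e
  simp only [restrict, Finset.mem_filter, mem_union]
  constructor
  · rintro ⟨⟨j, hj⟩, hi⟩
    by_cases hij : i = j
    · rwa [hij]
    · exact absurd (hS j hj) (Finset.disjoint_left.1 (hE i j hij) hi)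
  · exact fun h => ⟨⟨i, h⟩, hS i h⟩

theorem Gluing.piece_union (hG : Gluing V x) (hp : ∀ i, Piece (V i) (x ∘ idx i) (E i)) :
    Piece (union V) (ends x) (union E) where
  tmem i := by
    fin_cases i
    · exact subset_union V 0 (hG.corner_mem 0 0)
    · exact subset_union V 1 (hG.corner_mem 1 1)
    · exact subset_union V 2 (hG.corner_mem 2 2)
  tinj := by
    have : ends x = x ∘ ![0, 1, 2] := by
      funext i
      fin_cases i <;> rfl
    rw [this]
    exact hG.inj.comp (by decide)
  emem e he v hv := by
    obtain ⟨i, hi⟩ := mem_union.1 he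
    exact subset_union V i ((hp i).emem e hi v hv)
  ediag e he := by
    obtain ⟨i, hi⟩ := mem_union.1 he
    exact (hp i).ediag e hi
  excess S hS hr := by
    rw [← union_restrict hS] at hr ⊢
    have hF := edgeFam_of_piece hp (restrict_subset E S)
    obtain ⟨hle, hcl⟩ := hG.card_parts_le hp (restrict_subset E S) hr
    have h0 := hle 0
    have h1 := hle 1
    have h2 := hle 2
    have hc := hG.card_union hF
    have hv := hG.card_vertices
    rw [hG.stateOf_union hF]
    omega

/-- number of path covers with boundary state `s` -/
def count (V : Finset P) (t : Fin 3 → P) (E : Finset (Sym2 P)) (s : St) : ℕ :=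
  (E.powerset.filter fun S => Good V t S ∧ stateOf t S = s).card

theorem Gluing.count_union (hG : Gluing V x) (hp : ∀ i, Piece (V i) (x ∘ idx i) (E i)) {s : St}
    (hs : s.weight ≤ 8) : count (union V) (ends x) (union E) s =
      ((triples s).map fun t => count (V 0) (x ∘ idx 0) (E 0) t.1 *
        count (V 1) (x ∘ idx 1) (E 1) t.2.1 * count (V 2) (x ∘ idx 2) (E 2) t.2.2).sum := by
  have hdisj : ∀ i j, i ≠ j → Disjoint (E i) (E j) := fun i j hij =>
    hG.disjoint (edgeFam_of_piece hp fun i => subset_rfl) hij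
  rw [← List.sum_toFinset _ (triples_nodup s), count,
    Finset.card_eq_sum_card_fiberwise (t := (triples s).toFinset)
    (f := fun S => (parts x (restrict E S) 0, parts x (restrict E S) 1, parts x (restrict E S) 2))]
  · refine Finset.sum_congr rfl fun t ht => ?_
    obtain ⟨hA, hB, hC, hok, hst⟩ := mem_triples.1 (List.mem_toFinset.1 ht)
    obtain ⟨A, B, C⟩ := t
    have hprod : count (V 0) (x ∘ idx 0) (E 0) A * count (V 1) (x ∘ idx 1) (E 1) B *
        count (V 2) (x ∘ idx 2) (E 2) C =
        ∏ i, ((E i).powerset.filter fun S => Good (V i) (x ∘ idx i) S ∧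
          stateOf (x ∘ idx i) S = ![A, B, C] i).card := by
      rw [Fin.prod_univ_three]
      rfl
    rw [hprod, ← Fintype.card_piFinset]
    refine Finset.card_nbij' (restrict E) union ?_ ?_ ?_ ?_
    · intro S hS
      simp only [Finset.coe_filter, Finset.mem_filter, Finset.mem_powerset, Set.mem_ofPred_eq,
        Prod.mk.injEq] at hS
      obtain ⟨⟨hSE, hgood, -⟩, h0, h1, h2⟩ := hS
      rw [← union_restrict hSE, hG.good_union_iff hp (restrict_subset E S)] at hgood
      simp only [Finset.mem_coe, Fintype.mem_piFinset, Finset.mem_filter, Finset.mem_powerset]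
      intro i
      refine ⟨restrict_subset E S i, hgood.1 i, ?_⟩
      fin_cases i
      exacts [h0, h1, h2]
    · intro S hS
      simp only [Finset.mem_coe, Fintype.mem_piFinset, Finset.mem_filter,
        Finset.mem_powerset] at hS
      have hsub : ∀ i, S i ⊆ E i := fun i => (hS i).1
      have h0 : parts x S 0 = A := (hS 0).2.2
      have h1 : parts x S 1 = B := (hS 1).2.2
      have h2 : parts x S 2 = C := (hS 2).2.2
      simp only [Finset.coe_filter, Finset.mem_filter, Finset.mem_powerset, Set.mem_ofPred_eq,
        Prod.mk.injEq]
      rw [restrict_union hdisj hsub, h0, h1, h2, hG.good_union_iff hp hsub,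
        hG.stateOf_union (edgeFam_of_piece hp hsub), h0, h1, h2]
      refine ⟨⟨?_, ⟨fun i => (hS i).2.1, hok⟩, hst⟩, rfl, rfl, rfl⟩
      intro e he
      obtain ⟨i, hi⟩ := mem_union.1 he
      exact mem_union.2 ⟨i, hsub i hi⟩
    · intro S hS
      simp only [Finset.coe_filter, Finset.mem_filter, Finset.mem_powerset,
        Set.mem_ofPred_eq] at hS
      exact union_restrict hS.1.1
    · intro S hS
      simp only [Finset.mem_coe, Fintype.mem_piFinset, Finset.mem_filter,
        Finset.mem_powerset] at hS
      exact restrict_union hdisj fun i => (hS i).1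
  · intro S hS
    simp only [Finset.coe_filter, Finset.mem_powerset, Set.mem_ofPred_eq] at hS
    obtain ⟨hSE, hgood, hst⟩ := hS
    have hsub := restrict_subset E S
    rw [← union_restrict hSE, hG.good_union_iff hp hsub] at hgood
    rw [← union_restrict hSE, hG.stateOf_union (edgeFam_of_piece hp hsub)] at hst
    obtain ⟨hg, hok⟩ := hgood
    have hw := weight_glueSt hok
    obtain ⟨g3, g4, g5, -⟩ := glueOK_iff.1 hok
    rw [hst] at hw
    have w0 : 6 ≤ (parts x (restrict E S) 0).weight := (hp 0).weight_ge (hsub 0) (hg 0)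
    have w1 : 6 ≤ (parts x (restrict E S) 1).weight := (hp 1).weight_ge (hsub 1) (hg 1)
    have w2 : 6 ≤ (parts x (restrict E S) 2).weight := (hp 2).weight_ge (hsub 2) (hg 2)
    rw [Finset.mem_coe, List.mem_toFinset, mem_triples]
    exact ⟨(hp 0).mem_states (hsub 0) (hg 0) (by change (parts x (restrict E S) 0).weight ≤ 8; omega),
      (hp 1).mem_states (hsub 1) (hg 1) (by change (parts x (restrict E S) 1).weight ≤ 8; omega),
      (hp 2).mem_states (hsub 2) (hg 2) (by change (parts x (restrict E S) 2).weight ≤ 8; omega),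
      hok, hst⟩

end Counting

section Map

variable {P Q : Type*} (φ : P ↪ Q)

theorem mk_mem_map {S : Finset (Sym2 P)} {p q : P} :
    s(φ p, φ q) ∈ S.map φ.sym2Map ↔ s(p, q) ∈ S := by
  rw [← Finset.mem_map' φ.sym2Map]
  rfl

theorem exists_of_mem_map {S : Finset (Sym2 P)} {z w : Q} (h : s(z, w) ∈ S.map φ.sym2Map) :
    ∃ p q, z = φ p ∧ w = φ q ∧ s(p, q) ∈ S := by
  obtain ⟨e, he, h⟩ := Finset.mem_map.1 h
  induction e with
  | _ p q =>
    have h' : s(φ p, φ q) = s(z, w) := h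
    rcases Sym2.eq_iff.1 h' with ⟨rfl, rfl⟩ | ⟨rfl, rfl⟩
    · exact ⟨p, q, rfl, rfl, he⟩
    · exact ⟨q, p, rfl, rfl, Sym2.eq_swap ▸ he⟩

theorem conn_map {S : Finset (Sym2 P)} {p q : P} :
    Conn (S.map φ.sym2Map) (φ p) (φ q) ↔ Conn S p q := by
  constructor
  · intro h
    have : ∃ z', φ q = φ z' ∧ Conn S p z' := by
      refine Conn.induction (Q := fun z => ∃ z', z = φ z' ∧ Conn S p z')
        ⟨p, rfl, Conn.refl S p⟩ ?_ h
      rintro z w he ⟨z', rfl, hz'⟩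
      obtain ⟨p', q', h1, rfl, he'⟩ := exists_of_mem_map φ he
      have := φ.injective h1
      subst this
      exact ⟨q', rfl, hz'.trans (Conn.of_mem he')⟩
    obtain ⟨z', hz, h'⟩ := this
    rwa [φ.injective hz]
  · intro h
    refine Conn.induction (Q := fun z => Conn (S.map φ.sym2Map) (φ p) (φ z))
      (Conn.refl _ _) ?_ h
    intro z w he hz
    exact hz.trans (Conn.of_mem ((mk_mem_map φ).2 he))

theorem deg_map (S : Finset (Sym2 P)) (p : P) : deg (S.map φ.sym2Map) (φ p) = deg S p := by
  rw [deg, Finset.filter_map, Finset.card_map, deg]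
  congr 1
  refine Finset.filter_congr fun e _ => ?_
  induction e with
  | _ a b =>
    change φ p ∈ s(φ a, φ b) ↔ _
    simp

theorem stateOf_map (t : Fin 3 → P) (S : Finset (Sym2 P)) :
    stateOf (φ ∘ t) (S.map φ.sym2Map) = stateOf t S := by
  simp only [stateOf, Function.comp_apply, deg_map, conn_map]

theorem reach_map {V : Finset P} {t : Fin 3 → P} {S : Finset (Sym2 P)} :
    Reach (V.map φ) (φ ∘ t) (S.map φ.sym2Map) ↔ Reach V t S := by
  simp only [Reach, Finset.forall_mem_map, Function.comp_apply, conn_map]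

theorem good_map {V : Finset P} {t : Fin 3 → P} {S : Finset (Sym2 P)} :
    Good (V.map φ) (φ ∘ t) (S.map φ.sym2Map) ↔ Good V t S := by
  have hd : (∀ v ∈ V.map φ, deg (S.map φ.sym2Map) v ≤ 2) ↔ ∀ v ∈ V, deg S v ≤ 2 := by
    simp only [Finset.forall_mem_map, deg_map]
  constructor
  · rintro ⟨h1, h2, h3⟩
    rw [stateOf_map, Finset.card_map, Finset.card_map] at h3
    exact ⟨(reach_map φ).1 h1, hd.1 h2, h3⟩
  · rintro ⟨h1, h2, h3⟩
    refine ⟨(reach_map φ).2 h1, hd.2 h2, ?_⟩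
    rwa [stateOf_map, Finset.card_map, Finset.card_map]

theorem Piece.map {V : Finset P} {t : Fin 3 → P} {E : Finset (Sym2 P)} (hp : Piece V t E) :
    Piece (V.map φ) (φ ∘ t) (E.map φ.sym2Map) where
  tmem i := Finset.mem_map_of_mem φ (hp.tmem i)
  tinj := φ.injective.comp hp.tinj
  emem e he v hv := by
    induction e with
    | _ z w =>
      obtain ⟨p, q, rfl, rfl, he'⟩ := exists_of_mem_map φ he
      rcases Sym2.mem_iff.1 hv with rfl | rfl
      · exact Finset.mem_map_of_mem φ (hp.emem _ he' p (by simp))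
      · exact Finset.mem_map_of_mem φ (hp.emem _ he' q (by simp))
  ediag e he := by
    induction e with
    | _ z w =>
      obtain ⟨p, q, rfl, rfl, he'⟩ := exists_of_mem_map φ he
      have := hp.ediag _ he'
      rw [Sym2.mk_isDiag_iff] at this ⊢
      exact φ.injective.ne this
  excess S hS hr := by
    obtain ⟨S, hS', rfl⟩ := Finset.subset_map_iff.1 hS
    rw [stateOf_map, Finset.card_map, Finset.card_map]
    exact hp.excess S hS' ((reach_map φ).1 hr)

theorem count_map (V : Finset P) (t : Fin 3 → P) (E : Finset (Sym2 P)) (s : St) :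
    count (V.map φ) (φ ∘ t) (E.map φ.sym2Map) s = count V t E s := by
  symm
  refine Finset.card_nbij (fun S => S.map φ.sym2Map) ?_ ?_ ?_
  · intro S hS
    simp only [Finset.coe_filter, Finset.mem_powerset, Set.mem_ofPred_eq,
      Finset.map_subset_map, stateOf_map, good_map] at hS ⊢
    exact hS
  · intro S _ S' _ h
    exact Finset.map_injective _ h
  · intro S hS
    simp only [Finset.coe_filter, Finset.mem_powerset, Set.mem_ofPred_eq] at hS
    obtain ⟨hSE, hg, hst⟩ := hS
    obtain ⟨S, hS', rfl⟩ := Finset.subset_map_iff.1 hSE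
    rw [good_map] at hg
    rw [stateOf_map] at hst
    exact ⟨S, by simpa using ⟨hS', hg, hst⟩, rfl⟩

end Map

section Triangle

/-- edges of the triangle on `Fin 3` -/
def triE : Finset (Sym2 (Fin 3)) := {s(0, 1), s(0, 2), s(1, 2)}

/-- computable connectivity on the triangle -/
def triConn (S : Finset (Sym2 (Fin 3))) (i j : Fin 3) : Bool :=
  decide (i = j) || (decide (s(i, j) ∈ S) ||
    ((decide (s(i, 0) ∈ S) && decide (s(0, j) ∈ S)) ||
    ((decide (s(i, 1) ∈ S) && decide (s(1, j) ∈ S)) ||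
    (decide (s(i, 2) ∈ S) && decide (s(2, j) ∈ S)))))

theorem triConn_iff (S : Finset (Sym2 (Fin 3))) (i j : Fin 3) : triConn S i j = true ↔
    i = j ∨ s(i, j) ∈ S ∨ ∃ k, s(i, k) ∈ S ∧ s(k, j) ∈ S := by
  simp [triConn, Fin.exists_fin_succ]

theorem conn_fin_three (S : Finset (Sym2 (Fin 3))) (i j : Fin 3) :
    Conn S i j ↔ triConn S i j = true := by
  rw [triConn_iff]
  constructor
  · refine Conn.induction (Q := fun j => i = j ∨ s(i, j) ∈ S ∨ ∃ k, s(i, k) ∈ S ∧ s(k, j) ∈ S)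
      (Or.inl rfl) ?_
    rintro z z' he (rfl | h | ⟨k, h, h'⟩)
    · exact Or.inr (Or.inl he)
    · exact Or.inr (Or.inr ⟨z, h, he⟩)
    · have hpig : ∀ i k z z' : Fin 3, i = k ∨ k = z ∨ i = z ∨ i = z' ∨ k = z' ∨ z = z' := by
        decide
      rcases hpig i k z z' with rfl | rfl | rfl | rfl | rfl | rfl
      · exact Or.inr (Or.inr ⟨z, h', he⟩)
      · exact Or.inr (Or.inr ⟨k, h, he⟩)
      · exact Or.inr (Or.inl he)
      · exact Or.inl rfl
      · exact Or.inr (Or.inl h)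
      · exact Or.inr (Or.inr ⟨k, h, h'⟩)
  · rintro (rfl | h | ⟨k, h, h'⟩)
    · exact Conn.refl S i
    · exact Conn.of_mem h
    · exact (Conn.of_mem h).trans (Conn.of_mem h')

/-- computable degree on the triangle -/
def triDeg (S : Finset (Sym2 (Fin 3))) (i : Fin 3) : ℕ := (S.filter fun e => i ∈ e).card

theorem deg_eq_triDeg (S : Finset (Sym2 (Fin 3))) (i : Fin 3) : deg S i = triDeg S i := by
  unfold deg triDeg
  congr!

/-- computable boundary state on the triangle -/
def triSt (S : Finset (Sym2 (Fin 3))) : St :=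
  ⟨triDeg S 0, triDeg S 1, triDeg S 2, triConn S 0 1, triConn S 0 2, triConn S 1 2⟩

theorem stateOf_triangle (S : Finset (Sym2 (Fin 3))) : stateOf id S = triSt S := by
  have h : ∀ i j, decide (Conn S i j) = triConn S i j := fun i j => by
    rw [Bool.eq_iff_iff, decide_eq_true_eq, conn_fin_three]
  simp only [stateOf, triSt, id, deg_eq_triDeg, h]

/-- computable test for path covers of the triangle -/
def triGood (S : Finset (Sym2 (Fin 3))) (s : St) : Bool :=
  (triSt S).beq s && ((triDeg S 0).ble 2 && ((triDeg S 1).ble 2 && ((triDeg S 2).ble 2 &&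
    (S.card + (triSt S).classes).beq 3)))

theorem good_triangle_iff (S : Finset (Sym2 (Fin 3))) (s : St) :
    (Good Finset.univ id S ∧ stateOf id S = s) ↔ triGood S s = true := by
  simp only [triGood, Bool.and_eq_true, Nat.ble_eq, Nat.beq_eq, St.beq_iff]
  rw [and_comm, stateOf_triangle]
  refine and_congr_right fun _ => ⟨?_, ?_⟩
  · rintro ⟨-, hd, hc⟩
    rw [stateOf_triangle] at hc
    simp only [Finset.mem_univ, forall_const, deg_eq_triDeg] at hd
    exact ⟨hd 0, hd 1, hd 2, hc⟩
  · rintro ⟨h0, h1, h2, hc⟩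
    refine ⟨fun i _ => ⟨i, Conn.refl S i⟩, fun i _ => ?_, ?_⟩
    · rw [deg_eq_triDeg]
      fin_cases i
      exacts [h0, h1, h2]
    · rwa [stateOf_triangle]

theorem piece_triangle : Piece Finset.univ id triE where
  tmem _ := Finset.mem_univ _
  tinj := Function.injective_id
  emem _ _ _ _ := Finset.mem_univ _
  ediag e he := by
    revert e
    decide
  excess S hS _ := by
    rw [stateOf_triangle]
    have : ∀ S ∈ triE.powerset, Nat.ble 3 (S.card + (triSt S).classes) = true := by
      decide +kernel
    exact Nat.le_of_ble_eq_true (this S (Finset.mem_powerset.2 hS))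

/-- initial counts for the symmetry classes -/
def baseVal : ℕ → ℕ
  | 0 => 1
  | 1 => 1
  | 8 => 1
  | _ => 0

theorem count_triangle {s : St} (hs : s ∈ live) : count Finset.univ id triE s = baseVal s.cls := by
  have h : ∀ s ∈ live, (triE.powerset.filter fun S => triGood S s = true).card = baseVal s.cls := by
    decide +kernel
  rw [← h s hs, count]
  congr 1
  ext S
  simp only [Finset.mem_filter, good_triangle_iff]

end Triangle

section Geometry

theorem sq3_pos : 0 < sq3 := Real.sqrt_pos.2 (by norm_num)

/-- translation vectors -/
def shift (n : ℕ) : Fin 3 → ℝ × ℝ := ![0, a n, b n]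

/-- outmost vertices -/
def outm (n : ℕ) : Fin 3 → ℝ × ℝ := ![o, a n, b n]

/-- outmost vertices of the three copies of `SG n` in `SG (n + 1)` -/
def corner (n : ℕ) : Fin 6 → ℝ × ℝ := ![o, a (n + 1), b (n + 1), a n, b n, c n]

/-- abscissae of the corners, in units of `2 ^ n / 2` -/
def cornerX : Fin 6 → ℕ := ![0, 4, 2, 2, 1, 3]

/-- ordinates of the corners, in units of `2 ^ n / 2 * sq3` -/
def cornerY : Fin 6 → ℕ := ![0, 0, 2, 0, 1, 1]

theorem corner_eq (n : ℕ) (p : Fin 6) :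
    corner n p = ((2 : ℝ) ^ n / 2 * cornerX p, (2 : ℝ) ^ n / 2 * sq3 * cornerY p) := by
  fin_cases p <;> simp [corner, cornerX, cornerY, o, a, b, c] <;> ring_nf <;> simp

theorem corner_idx (n : ℕ) (i : Fin 3) :
    corner n ∘ idx i = addRightEmbedding (shift n i) ∘ outm n := by
  funext l
  fin_cases i <;> fin_cases l <;>
    simp [corner, idx, shift, outm, o, a, b, c, addRightEmbedding, Prod.ext_iff] <;> ring_nf <;>
    simp

theorem corner_injective (n : ℕ) : Function.Injective (corner n) := by
  intro p q h
  rw [corner_eq, corner_eq, Prod.mk.injEq] at h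
  have h2 : (2 : ℝ) ^ n / 2 ≠ 0 := by positivity
  have h3 : (2 : ℝ) ^ n / 2 * sq3 ≠ 0 := mul_ne_zero h2 sq3_pos.ne'
  have hx : cornerX p = cornerX q := by exact_mod_cast mul_left_cancel₀ h2 h.1
  have hy : cornerY p = cornerY q := by exact_mod_cast mul_left_cancel₀ h3 h.2
  have key : ∀ p q, cornerX p = cornerX q → cornerY p = cornerY q → p = q := by decide
  exact key p q hx hy

theorem outm_injective (n : ℕ) : Function.Injective (outm n) := by
  have h := corner_idx n 0
  have : addRightEmbedding (shift n 0) ∘ outm n = outm n := by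
    funext l
    simp [addRightEmbedding, shift]
  rw [← this, ← h]
  exact (corner_injective n).comp (by decide)

/-- the vertices of `SG n` as a finset -/
def Vf : ℕ → Finset (ℝ × ℝ)
  | 0 => Finset.univ.map ⟨outm 0, outm_injective 0⟩
  | n + 1 => union fun i => (Vf n).map (addRightEmbedding (shift n i))

/-- the edges of `SG n` as a finset -/
def Ef : ℕ → Finset (Sym2 (ℝ × ℝ))
  | 0 => triE.map (Function.Embedding.sym2Map ⟨outm 0, outm_injective 0⟩)
  | n + 1 => union fun i => (Ef n).map (addRightEmbedding (shift n i)).sym2Map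

theorem coe_Vf (n : ℕ) : (Vf n : Set (ℝ × ℝ)) = V n := by
  induction n with
  | zero =>
    ext v
    simp only [Vf, V, outm, Finset.coe_map, Function.Embedding.coeFn_mk, Set.mem_image,
      Finset.mem_coe, Finset.mem_univ, true_and, Set.mem_insert_iff, Set.mem_singleton_iff,
      Fin.exists_fin_succ]
    simp [eq_comm]
  | succ n ih =>
    ext v
    simp only [Vf, V, ← ih, Finset.mem_coe, mem_union, Finset.mem_map, Set.mem_union,
      Set.mem_image, Fin.exists_fin_succ]
    simp [shift, addRightEmbedding, or_assoc]

theorem coe_Ef (n : ℕ) : (Ef n : Set (Sym2 (ℝ × ℝ))) = E n := by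
  induction n with
  | zero =>
    ext v
    simp [Ef, E, triE, outm, Function.Embedding.sym2Map]
  | succ n ih =>
    ext v
    simp only [Ef, E, ← ih, Finset.mem_coe, mem_union, Finset.mem_map, Set.mem_union,
      Set.mem_image, Fin.exists_fin_succ]
    simp [shift, addRightEmbedding, or_assoc, Function.Embedding.sym2Map]

theorem Vf_bounds (n : ℕ) {v : ℝ × ℝ} (hv : v ∈ Vf n) :
    0 ≤ v.2 ∧ v.2 ≤ sq3 * v.1 ∧ sq3 * v.1 + v.2 ≤ sq3 * 2 ^ n := by
  have h3 := sq3_pos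
  induction n generalizing v with
  | zero =>
    obtain ⟨i, -, rfl⟩ := Finset.mem_map.1 hv
    fin_cases i <;>
      simp only [outm, o, a, b, Function.Embedding.coeFn_mk, Fin.zero_eta, Fin.mk_one,
        Fin.reduceFinMk, Matrix.cons_val_zero, Matrix.cons_val_one, Matrix.cons_val, pow_zero] <;>
      refine ⟨?_, ?_, ?_⟩ <;> linarith
  | succ n ih =>
    obtain ⟨i, hi⟩ := mem_union.1 hv
    obtain ⟨w, hw, rfl⟩ := Finset.mem_map.1 hi
    obtain ⟨h0, h1, h2⟩ := ih hw
    have hK : 0 < sq3 * 2 ^ n := by positivity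
    have e : sq3 * 2 ^ (n + 1) = 2 * (sq3 * 2 ^ n) := by ring
    have e2 : 2 ^ n / 2 * sq3 = sq3 * 2 ^ n / 2 := by ring
    have e3 : sq3 * (w.1 + 2 ^ n) = sq3 * w.1 + sq3 * 2 ^ n := by ring
    have e4 : sq3 * (w.1 + 2 ^ n / 2) = sq3 * w.1 + sq3 * 2 ^ n / 2 := by ring
    fin_cases i <;>
      simp only [shift, a, b, addRightEmbedding, Function.Embedding.coeFn_mk, Fin.zero_eta,
        Fin.mk_one, Fin.reduceFinMk, Matrix.cons_val_zero, Matrix.cons_val_one, Matrix.cons_val,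
        Prod.fst_add, Prod.snd_add, Prod.fst_zero, Prod.snd_zero, e, e2, e3, e4] <;>
      refine ⟨?_, ?_, ?_⟩ <;> linarith

theorem copy_bounds (n : ℕ) (i : Fin 3) {v : ℝ × ℝ}
    (hv : v ∈ (Vf n).map (addRightEmbedding (shift n i))) :
    (i = 0 → sq3 * v.1 + v.2 ≤ sq3 * 2 ^ n) ∧ (i = 1 → sq3 * 2 ^ n + v.2 ≤ sq3 * v.1) ∧
      (i = 2 → sq3 * 2 ^ n / 2 ≤ v.2) ∧ 0 ≤ v.2 ∧ v.2 ≤ sq3 * v.1 ∧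
      sq3 * v.1 + v.2 ≤ 2 * (sq3 * 2 ^ n) := by
  have hb : v ∈ Vf (n + 1) := mem_union.2 ⟨i, hv⟩
  obtain ⟨b1, b2, b3⟩ := Vf_bounds (n + 1) hb
  obtain ⟨w, hw, rfl⟩ := Finset.mem_map.1 hv
  obtain ⟨h0, h1, h2⟩ := Vf_bounds n hw
  refine ⟨?_, ?_, ?_, b1, b2, b3.trans_eq (by ring)⟩
  · rintro rfl
    simpa [shift, addRightEmbedding] using h2
  · rintro rfl
    simp only [shift, a, addRightEmbedding, Function.Embedding.coeFn_mk, Matrix.cons_val_one,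
      Matrix.cons_val_zero, Prod.fst_add, Prod.snd_add, mul_add]
    linarith
  · rintro rfl
    simp only [shift, b, addRightEmbedding, Function.Embedding.coeFn_mk, Matrix.cons_val,
      Prod.snd_add]
    linarith

theorem corner_ends (n : ℕ) : ends (corner n) = outm (n + 1) := by
  funext l
  fin_cases l <;> rfl

theorem outm_mem (n : ℕ) (l : Fin 3) : outm n l ∈ Vf n := by
  induction n generalizing l with
  | zero => exact Finset.mem_map_of_mem _ (Finset.mem_univ l)
  | succ n ih =>
    have h := congrFun (corner_idx n l) l
    have hl : (corner n ∘ idx l) l = outm (n + 1) l := by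
      fin_cases l <;> rfl
    rw [← hl, h]
    exact mem_union.2 ⟨l, Finset.mem_map_of_mem _ (ih l)⟩

theorem gluing_SG (n : ℕ) :
    Gluing (fun i => (Vf n).map (addRightEmbedding (shift n i))) (corner n) := by
  have h3 := sq3_pos
  have hK : 0 < sq3 * 2 ^ n / 2 := by positivity
  have hout := outm_mem n
  refine ⟨corner_injective n, fun i p => ⟨fun h => ?_, ?_⟩, ?_⟩
  · obtain ⟨h0, h1, h2, -⟩ := copy_bounds n i h
    rw [corner_eq] at h0 h1 h2
    dsimp only at h0 h1 h2
    have k0 : i = 0 → cornerX p + cornerY p ≤ 2 := fun hi => by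
      have : sq3 * 2 ^ n / 2 * (cornerX p + cornerY p : ℝ) ≤ sq3 * 2 ^ n / 2 * 2 := by
        linarith [h0 hi]
      exact_mod_cast le_of_mul_le_mul_left this hK
    have k1 : i = 1 → 2 + cornerY p ≤ cornerX p := fun hi => by
      have : sq3 * 2 ^ n / 2 * (2 + cornerY p : ℝ) ≤ sq3 * 2 ^ n / 2 * cornerX p := by
        linarith [h1 hi]
      exact_mod_cast le_of_mul_le_mul_left this hK
    have k2 : i = 2 → 1 ≤ cornerY p := fun hi => by
      have : sq3 * 2 ^ n / 2 * (1 : ℝ) ≤ sq3 * 2 ^ n / 2 * cornerY p := by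
        linarith [h2 hi]
      exact_mod_cast le_of_mul_le_mul_left this hK
    clear h h0 h1 h2
    revert i p
    decide
  · rintro ⟨l, rfl⟩
    have := congrFun (corner_idx n i) l
    rw [Function.comp_apply, Function.comp_apply] at this
    rw [this]
    exact Finset.mem_map_of_mem _ (hout l)
  · have sep : ∀ v : ℝ × ℝ, ∀ p, sq3 * v.1 = sq3 * 2 ^ n / 2 * cornerX p →
        v.2 = sq3 * 2 ^ n / 2 * cornerY p → v = corner n p := by
      intro v p h1 h2
      rw [corner_eq]
      refine Prod.ext ?_ ?_
      · refine mul_left_cancel₀ h3.ne' ?_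
        dsimp only
        rw [h1]
        ring
      · rw [h2]
        ring
    have s01 : ∀ v, v ∈ (Vf n).map (addRightEmbedding (shift n 0)) →
        v ∈ (Vf n).map (addRightEmbedding (shift n 1)) → ∃ p, v = corner n p := by
      intro v hv hv'
      obtain ⟨h0, -, -, g1, g2, g3⟩ := copy_bounds n 0 hv
      obtain ⟨-, h1, -, -⟩ := copy_bounds n 1 hv'
      have h0 := h0 rfl
      have h1 := h1 rfl
      have hX : (cornerX 3 : ℝ) = 2 := by simp [cornerX]
      have hY : (cornerY 3 : ℝ) = 0 := by simp [cornerY]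
      refine ⟨3, sep v 3 ?_ ?_⟩
      · rw [hX]
        linarith
      · rw [hY]
        linarith
    have s02 : ∀ v, v ∈ (Vf n).map (addRightEmbedding (shift n 0)) →
        v ∈ (Vf n).map (addRightEmbedding (shift n 2)) → ∃ p, v = corner n p := by
      intro v hv hv'
      obtain ⟨h0, -, -, g1, g2, g3⟩ := copy_bounds n 0 hv
      obtain ⟨-, -, h1, -⟩ := copy_bounds n 2 hv'
      have h0 := h0 rfl
      have h1 := h1 rfl
      have hX : (cornerX 4 : ℝ) = 1 := by simp [cornerX]
      have hY : (cornerY 4 : ℝ) = 1 := by simp [cornerY]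
      refine ⟨4, sep v 4 ?_ ?_⟩
      · rw [hX]
        linarith
      · rw [hY]
        linarith
    have s12 : ∀ v, v ∈ (Vf n).map (addRightEmbedding (shift n 1)) →
        v ∈ (Vf n).map (addRightEmbedding (shift n 2)) → ∃ p, v = corner n p := by
      intro v hv hv'
      obtain ⟨-, h0, -, g1, g2, g3⟩ := copy_bounds n 1 hv
      obtain ⟨-, -, h1, -⟩ := copy_bounds n 2 hv'
      have h0 := h0 rfl
      have h1 := h1 rfl
      have hX : (cornerX 5 : ℝ) = 3 := by simp [cornerX]
      have hY : (cornerY 5 : ℝ) = 1 := by simp [cornerY]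
      refine ⟨5, sep v 5 ?_ ?_⟩
      · rw [hX]
        linarith
      · rw [hY]
        linarith
    intro i j hij v hv hv'
    fin_cases i <;> fin_cases j
    · exact absurd rfl hij
    · exact s01 v hv hv'
    · exact s02 v hv hv'
    · exact s01 v hv' hv
    · exact absurd rfl hij
    · exact s12 v hv hv'
    · exact s02 v hv' hv
    · exact s12 v hv' hv
    · exact absurd rfl hij

end Geometry

theorem copy_piece {n : ℕ} (h : Piece (Vf n) (outm n) (Ef n)) (i : Fin 3) :
    Piece ((Vf n).map (addRightEmbedding (shift n i))) (corner n ∘ idx i)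
      ((Ef n).map (addRightEmbedding (shift n i)).sym2Map) := by
  rw [corner_idx]
  exact h.map _

theorem piece_SG (n : ℕ) : Piece (Vf n) (outm n) (Ef n) := by
  induction n with
  | zero => exact piece_triangle.map ⟨outm 0, outm_injective 0⟩
  | succ n ih =>
    rw [← corner_ends]
    exact (gluing_SG n).piece_union (copy_piece ih)

/-- `val n c` is the number of path covers of `SG n` with a given boundary state of class `c` -/
def val : ℕ → ℕ → ℕ
  | 0, c => baseVal c
  | n + 1, c => ((coeffs c).map fun q => q.1 * (val n q.2.1 * val n q.2.2.1 * val n q.2.2.2)).sum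

theorem count_SG (n : ℕ) {s : St} (hs : s ∈ live) :
    count (Vf n) (outm n) (Ef n) s = val n s.cls := by
  induction n generalizing s with
  | zero =>
    rw [val, ← count_triangle hs]
    exact count_map ⟨outm 0, outm_injective 0⟩ Finset.univ id triE s
  | succ n ih =>
    have h := (gluing_SG n).count_union (copy_piece (piece_SG n))
      (states_weight s (mem_live.1 hs).1).2
    rw [corner_ends] at h
    rw [val, ← sum_triples (val n) hs]
    refine h.trans (congrArg List.sum (List.map_congr_left fun t ht => ?_))
    obtain ⟨h0, h1, h2, -⟩ := mem_triples.1 ht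
    obtain ⟨c0, c1, c2⟩ := triples_cls_le hs ht
    simp only [corner_idx, count_map]
    rw [ih (mem_live.2 ⟨h0, c0⟩), ih (mem_live.2 ⟨h1, c1⟩), ih (mem_live.2 ⟨h2, c2⟩)]

section Bridge

variable {P : Type*}

/-- the edges of a walk as a finset -/
def walkEdges {G : SimpleGraph P} {u v : P} (p : G.Walk u v) : Finset (Sym2 P) := p.edges.toFinset

theorem mem_walkEdges {G : SimpleGraph P} {u v : P} {p : G.Walk u v} {e : Sym2 P} :
    e ∈ walkEdges p ↔ e ∈ p.edges := List.mem_toFinset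

theorem conn_of_mem_support {G : SimpleGraph P} {u v : P} (p : G.Walk u v) {x : P}
    (hx : x ∈ p.support) : Conn (walkEdges p) u x := by
  induction p with
  | nil =>
    rw [SimpleGraph.Walk.mem_support_nil_iff] at hx
    rw [hx]
    exact Conn.refl _ _
  | cons h p ih =>
    rw [SimpleGraph.Walk.support_cons, List.mem_cons] at hx
    rcases hx with rfl | hx
    · exact Conn.refl _ _
    · refine (Conn.of_mem (mem_walkEdges.2 (by simp))).trans ((ih hx).mono fun e he => ?_)
      exact mem_walkEdges.2 (List.mem_cons_of_mem _ (mem_walkEdges.1 he))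

theorem deg_insert {S : Finset (Sym2 P)} {u w : P} (huw : u ≠ w) (h : s(u, w) ∉ S) (x : P) :
    deg (insert s(u, w) S) x = deg S x + (if x = u then 1 else 0) + if x = w then 1 else 0 := by
  unfold deg
  rw [Finset.filter_insert]
  by_cases hu : x = u
  · subst hu
    rw [if_pos (by simp), Finset.card_insert_of_notMem (by simp [h])]
    simp [huw]
  · by_cases hw : x = w
    · subst hw
      rw [if_pos (by simp), Finset.card_insert_of_notMem (by simp [h])]
      simp [huw.symm]
    · simp [hu, hw]

theorem deg_path {G : SimpleGraph P} {u v : P} {p : G.Walk u v} (hp : p.IsPath) (x : P) :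
    deg (walkEdges p) x + (if x = u then 1 else 0) + (if x = v then 1 else 0) =
      if x ∈ p.support then 2 else 0 := by
  induction p with
  | @nil u => by_cases h : x = u <;> simp [walkEdges, deg, h]
  | @cons u w v h p ih =>
    rw [SimpleGraph.Walk.cons_isPath_iff] at hp
    have hn : s(u, w) ∉ walkEdges p := fun hm =>
      hp.2 (p.fst_mem_support_of_mem_edges (mem_walkEdges.1 hm))
    have he : walkEdges (SimpleGraph.Walk.cons h p) = insert s(u, w) (walkEdges p) := by
      ext e
      simp [mem_walkEdges]
    have ih := ih hp.1
    rw [he, deg_insert h.ne hn]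
    simp only [SimpleGraph.Walk.support_cons, List.mem_cons]
    by_cases hu : x = u
    · subst hu
      simp only [hp.2, if_false, if_true, true_or, h.ne] at ih ⊢
      omega
    · simp only [hu, if_false, false_or] at ih ⊢
      omega

theorem card_walkEdges {G : SimpleGraph P} {u v : P} {p : G.Walk u v} (hp : p.IsPath) :
    (walkEdges p).card + 1 = p.support.toFinset.card := by
  rw [walkEdges, List.toFinset_card_of_nodup hp.isTrail.edges_nodup,
    List.toFinset_card_of_nodup hp.support_nodup, SimpleGraph.Walk.length_edges,
    SimpleGraph.Walk.length_support]

theorem path_ext {G : SimpleGraph P} {u v : P} {p q : G.Walk u v} (hp : p.IsPath) (hq : q.IsPath)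
    (h : ∀ e, e ∈ p.edges ↔ e ∈ q.edges) : p = q := by
  induction p with
  | nil =>
    cases q with
    | nil => rfl
    | cons h' q => exact absurd ((h _).2 (List.mem_cons_self)) (by simp)
  | @cons u w v h' p ih =>
    cases q with
    | nil => exact absurd ((h _).1 (List.mem_cons_self)) (by simp)
    | @cons _ w' _ h'' q =>
      rw [SimpleGraph.Walk.cons_isPath_iff] at hp hq
      have hpn : ∀ z, s(u, z) ∉ p.edges := fun z hm => hp.2 (p.fst_mem_support_of_mem_edges hm)
      have hqn : ∀ z, s(u, z) ∉ q.edges := fun z hm => hq.2 (q.fst_mem_support_of_mem_edges hm)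
      simp only [SimpleGraph.Walk.edges_cons, List.mem_cons] at h
      have hw : w = w' := by
        have := (h s(u, w)).1 (Or.inl rfl)
        rcases this with h1 | h1
        · exact Sym2.congr_right.1 h1
        · exact absurd h1 (hqn _)
      subst hw
      rw [ih hp.1 hq.1 fun e => ?_]
      by_cases he : e = s(u, w)
      · subst he
        simp [hpn, hqn]
      · simpa [he] using h e

/-- `S` is the edge set of a Hamiltonian path of `V` -/
structure SpanPath (V : Finset P) (S : Finset (Sym2 P)) : Prop where
  conn : ∀ x ∈ V, ∀ y ∈ V, Conn S x y
  deg_le : ∀ x ∈ V, deg S x ≤ 2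
  card_add : S.card + 1 = V.card

theorem deg_mono {S T : Finset (Sym2 P)} (h : S ⊆ T) (x : P) : deg S x ≤ deg T x :=
  Finset.card_le_card (Finset.filter_subset_filter _ h)

theorem SpanPath.of_walk {G : SimpleGraph P} {V : Finset P} {u v : P} {p : G.Walk u v}
    (hp : p.IsPath) (hV : ∀ x, x ∈ p.support ↔ x ∈ V) : SpanPath V (walkEdges p) where
  conn x hx y hy := (conn_of_mem_support p ((hV x).2 hx)).symm.trans
    (conn_of_mem_support p ((hV y).2 hy))
  deg_le x hx := by
    have := deg_path hp x
    rw [if_pos ((hV x).2 hx)] at this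
    omega
  card_add := by
    rw [card_walkEdges hp]
    congr 1
    ext x
    rw [List.mem_toFinset, hV]

theorem SpanPath.exists_walk {V : Finset P} {S : Finset (Sym2 P)} (hS : SpanPath V S)
    (hV : ∀ e ∈ S, ∀ x ∈ e, x ∈ V) {u v : P} (hu : u ∈ V) (hv : v ∈ V) (huv : u ≠ v)
    (du : deg S u = 1) (dv : deg S v = 1) :
    ∃ p : (SimpleGraph.fromEdgeSet (S : Set (Sym2 P))).Walk u v,
      p.IsPath ∧ (∀ x, x ∈ p.support ↔ x ∈ V) ∧ walkEdges p = S := by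
  obtain ⟨p, hp⟩ := SimpleGraph.Reachable.exists_isPath (hS.conn u hu v hv)
  have hsub : walkEdges p ⊆ S := fun e he => by
    have := p.edges_subset_edgeSet (mem_walkEdges.1 he)
    rw [SimpleGraph.edgeSet_fromEdgeSet] at this
    exact this.1
  have hdeg : ∀ x ∈ p.support, x ∈ V → deg (walkEdges p) x = deg S x := by
    intro x hx hxV
    have h1 := deg_path hp x
    have h2 := hS.deg_le x hxV
    have h3 := deg_mono hsub x
    rw [if_pos hx] at h1
    by_cases hxu : x = u
    · subst hxu
      rw [if_pos rfl, if_neg huv] at h1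
      omega
    · by_cases hxv : x = v
      · subst hxv
        rw [if_pos rfl, if_neg hxu] at h1
        omega
      · rw [if_neg hxu, if_neg hxv] at h1
        omega
  have hclosed : ∀ x y, s(x, y) ∈ S → x ∈ p.support → y ∈ p.support := by
    intro x y he hx
    have hfil : (walkEdges p).filter (x ∈ ·) = S.filter (x ∈ ·) :=
      Finset.eq_of_subset_of_card_le (Finset.filter_subset_filter _ hsub)
        (hdeg x hx (hV _ he x (by simp))).ge
    have : s(x, y) ∈ (walkEdges p).filter (x ∈ ·) := by
      rw [hfil]
      exact Finset.mem_filter.2 ⟨he, by simp⟩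
    exact p.snd_mem_support_of_mem_edges (mem_walkEdges.1 (Finset.mem_filter.1 this).1)
  have hsupp : ∀ x, x ∈ p.support ↔ x ∈ V := by
    refine fun x => ⟨fun hx => ?_, fun hx => ?_⟩
    · exact Conn.induction (Q := (· ∈ V)) hu (fun z z' he _ => hV _ he z' (by simp))
        ((conn_of_mem_support p hx).mono hsub)
    · exact Conn.induction (Q := (· ∈ p.support)) p.start_mem_support hclosed (hS.conn u hu x hx)
  refine ⟨p, hp, hsupp, Finset.eq_of_subset_of_card_le hsub ?_⟩
  have h1 := (SpanPath.of_walk hp hsupp).card_add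
  have h2 := hS.card_add
  omega

/-- the Hamiltonian paths of the graph `(V, E)`, as edge sets -/
def spanPaths (V : Finset P) (E : Finset (Sym2 P)) : Finset (Finset (Sym2 P)) :=
  E.powerset.filter (SpanPath V)

variable {V : Finset P} {E : Finset (Sym2 P)}

theorem mem_spanPaths {S : Finset (Sym2 P)} : S ∈ spanPaths V E ↔ S ⊆ E ∧ SpanPath V S := by
  rw [spanPaths, Finset.mem_filter, Finset.mem_powerset]

/-- the Hamiltonian paths from `u` to `v` -/
abbrev HamWalks (V : Finset P) (E : Finset (Sym2 P)) (u v : P) : Type _ :=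
  {p : (SimpleGraph.fromEdgeSet (E : Set (Sym2 P))).Walk u v //
    p.IsPath ∧ ∀ x, x ∈ p.support ↔ x ∈ V}

theorem card_hamWalks (hV : ∀ e ∈ E, ∀ x ∈ e, x ∈ V) {u v : P} (hu : u ∈ V) (hv : v ∈ V)
    (huv : u ≠ v) : Nat.card (HamWalks V E u v) =
      ((spanPaths V E).filter fun S => deg S u = 1 ∧ deg S v = 1).card := by
  have hmem : ∀ p : HamWalks V E u v, walkEdges p.1 ∈
      (spanPaths V E).filter fun S => deg S u = 1 ∧ deg S v = 1 := by
    rintro ⟨p, hp, hs⟩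
    refine Finset.mem_filter.2 ⟨mem_spanPaths.2 ⟨fun e he => ?_, SpanPath.of_walk hp hs⟩, ?_⟩
    · have := p.edges_subset_edgeSet (mem_walkEdges.1 he)
      rw [SimpleGraph.edgeSet_fromEdgeSet] at this
      exact this.1
    · have h1 := deg_path hp u
      have h2 := deg_path hp v
      rw [if_pos rfl, if_neg huv, if_pos p.start_mem_support] at h1
      rw [if_pos rfl, if_neg huv.symm, if_pos p.end_mem_support] at h2
      refine ⟨?_, ?_⟩
      · change deg (walkEdges p) u = 1
        omega
      · change deg (walkEdges p) v = 1
        omega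
  rw [← Fintype.card_coe, ← Nat.card_eq_fintype_card]
  refine Nat.card_eq_of_bijective (fun p => ⟨walkEdges p.1, hmem p⟩) ⟨?_, ?_⟩
  · rintro ⟨p, hp, _⟩ ⟨q, hq, _⟩ h
    refine Subtype.ext (path_ext hp hq fun e => ?_)
    rw [← mem_walkEdges, ← mem_walkEdges]
    exact Finset.ext_iff.1 (congrArg Subtype.val h) e
  · rintro ⟨S, hS⟩
    obtain ⟨hS, hSu, hSv⟩ := Finset.mem_filter.1 hS
    obtain ⟨hSE, hS⟩ := mem_spanPaths.1 hS
    obtain ⟨p, hp, hs, hpS⟩ := hS.exists_walk (fun e he => hV e (hSE he)) hu hv huv hSu hSv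
    have hle : SimpleGraph.fromEdgeSet (S : Set (Sym2 P)) ≤ SimpleGraph.fromEdgeSet E :=
      SimpleGraph.fromEdgeSet_mono (Finset.coe_subset.2 hSE)
    refine ⟨⟨p.mapLe hle, hp.mapLe hle, fun x => ?_⟩, Subtype.ext ?_⟩
    · rw [SimpleGraph.Walk.support_mapLe_eq_support, hs]
    · refine Eq.trans ?_ hpS
      simp only [walkEdges, SimpleGraph.Walk.edges_mapLe_eq_edges]

theorem card_hamWalks_self (hc : 2 ≤ V.card) (u : P) : Nat.card (HamWalks V E u u) = 0 := by
  rw [Nat.card_eq_zero]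
  refine Or.inl ⟨fun ⟨p, hp, hs⟩ => ?_⟩
  have h := card_walkEdges hp
  have hV : p.support.toFinset = V := by
    ext x
    rw [List.mem_toFinset, hs]
  have hu := deg_path hp u
  rw [if_pos rfl, if_pos p.start_mem_support, SimpleGraph.Walk.isPath_iff_nil] at *
  rw [SimpleGraph.Walk.nil_iff_support_eq.1 hp] at hV
  rw [← hV] at hc
  simp at hc

theorem card_hamWalks_of_notMem {u v : P} (h : u ∉ V ∨ v ∉ V) :
    Nat.card (HamWalks V E u v) = 0 := by
  rw [Nat.card_eq_zero]
  refine Or.inl ⟨fun ⟨p, hp, hs⟩ => ?_⟩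
  rcases h with h | h
  · exact h ((hs u).1 p.start_mem_support)
  · exact h ((hs v).1 p.end_mem_support)

theorem SpanPath.card_leaves {S : Finset (Sym2 P)} (hS : SpanPath V S)
    (hV : ∀ e ∈ S, ∀ x ∈ e, x ∈ V) (hd : ∀ e ∈ S, ¬ e.IsDiag) (hc : 2 ≤ V.card) :
    (V.filter fun x => deg S x = 1).card = 2 := by
  have h1 := sum_deg hV hd
  have h2 : ∑ x ∈ V, (deg S x + if deg S x = 1 then 1 else 0) = ∑ x ∈ V, 2 := by
    refine Finset.sum_congr rfl fun x hx => ?_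
    obtain ⟨y, hy, hyx⟩ := Finset.exists_mem_ne hc x
    have h3 := deg_pos hyx.symm (hS.conn x hx y hy)
    have h4 := hS.deg_le x hx
    split_ifs <;> omega
  rw [Finset.sum_add_distrib, ← Finset.card_filter, Finset.sum_const, smul_eq_mul] at h2
  have := hS.card_add
  omega

theorem sum_card_hamWalks (hV : ∀ e ∈ E, ∀ x ∈ e, x ∈ V) (hd : ∀ e ∈ E, ¬ e.IsDiag)
    (hc : 2 ≤ V.card) {u : P} (hu : u ∈ V) : ∑ v ∈ V, Nat.card (HamWalks V E u v) =
      ((spanPaths V E).filter fun S => deg S u = 1).card := by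
  have h := Finset.sum_card_bipartiteAbove_eq_sum_card_bipartiteBelow
    (fun (v : P) (S : Finset (Sym2 P)) => deg S v = 1) (s := V.erase u)
    (t := (spanPaths V E).filter fun S => deg S u = 1)
  rw [← Finset.add_sum_erase V _ hu, card_hamWalks_self hc, zero_add]
  trans ∑ v ∈ V.erase u, (Finset.bipartiteAbove (fun (v : P) (S : Finset (Sym2 P)) => deg S v = 1)
    ((spanPaths V E).filter fun S => deg S u = 1) v).card
  · refine Finset.sum_congr rfl fun v hv => ?_
    rw [card_hamWalks hV hu (Finset.mem_of_mem_erase hv) (Finset.ne_of_mem_erase hv).symm,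
      Finset.bipartiteAbove, Finset.filter_filter]
  · rw [h, Finset.sum_const_nat (m := 1), mul_one]
    intro S hS
    obtain ⟨hS, hSu⟩ := Finset.mem_filter.1 hS
    obtain ⟨hSE, hS⟩ := mem_spanPaths.1 hS
    have h2 := hS.card_leaves (fun e he => hV e (hSE he)) (fun e he => hd e (hSE he)) hc
    rw [Finset.bipartiteBelow, Finset.filter_erase, Finset.card_erase_of_mem, h2]
    exact Finset.mem_filter.2 ⟨hu, hSu⟩

theorem sum_sum_card_hamWalks (hV : ∀ e ∈ E, ∀ x ∈ e, x ∈ V) (hd : ∀ e ∈ E, ¬ e.IsDiag)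
    (hc : 2 ≤ V.card) : ∑ u ∈ V, ∑ v ∈ V, Nat.card (HamWalks V E u v) =
      (spanPaths V E).card * 2 := by
  have h := Finset.sum_card_bipartiteAbove_eq_sum_card_bipartiteBelow
    (fun (v : P) (S : Finset (Sym2 P)) => deg S v = 1) (s := V) (t := spanPaths V E)
  trans ∑ u ∈ V, (Finset.bipartiteAbove (fun (v : P) (S : Finset (Sym2 P)) => deg S v = 1)
    (spanPaths V E) u).card
  · exact Finset.sum_congr rfl fun u hu => sum_card_hamWalks hV hd hc hu
  · rw [h, Finset.sum_const_nat (m := 2)]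
    intro S hS
    obtain ⟨hSE, hS⟩ := mem_spanPaths.1 hS
    exact hS.card_leaves (fun e he => hV e (hSE he)) (fun e he => hd e (hSE he)) hc

theorem spanPath_iff {t : Fin 3 → P} (ht : ∀ i, t i ∈ V) (S : Finset (Sym2 P)) :
    SpanPath V S ↔ Good V t S ∧ (stateOf t S).classes = 1 := by
  have hcl : ∀ s : St, s.classes = 1 ↔ s.c01 = true ∧ s.c02 = true := by
    rintro ⟨d0, d1, d2, c01, c02, c12⟩
    cases c01 <;> cases c02 <;> cases c12 <;> simp [St.classes]
  rw [hcl]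
  simp only [stateOf, decide_eq_true_eq]
  constructor
  · intro h
    have h12 := And.intro (h.conn _ (ht 0) _ (ht 1)) (h.conn _ (ht 0) _ (ht 2))
    refine ⟨⟨fun x hx => ⟨0, h.conn x hx _ (ht 0)⟩, h.deg_le, ?_⟩, h12⟩
    rw [(hcl (stateOf t S)).2 (by simpa [stateOf] using h12)]
    exact h.card_add
  · rintro ⟨h, h1, h2⟩
    have h0 : ∀ x ∈ V, Conn S (t 0) x := by
      intro x hx
      obtain ⟨i, hi⟩ := h.reach x hx
      fin_cases i
      exacts [hi.symm, h1.trans hi.symm, h2.trans hi.symm]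
    refine ⟨fun x hx y hy => (h0 x hx).symm.trans (h0 y hy), h.deg_le, ?_⟩
    rw [← (hcl (stateOf t S)).2 (by simpa [stateOf] using And.intro h1 h2)]
    exact h.card_add

theorem Piece.card_spanPaths {t : Fin 3 → P} (hp : Piece V t E) (r : St → Bool) :
    ((spanPaths V E).filter fun S => r (stateOf t S) = true).card =
      ((states.filter fun s => s.classes.beq 1 && r s).map (count V t E)).sum := by
  rw [← List.sum_toFinset _ (states_nodup.filter _), Finset.card_eq_sum_card_fiberwise
    (f := stateOf t) (t := (states.filter fun s => s.classes.beq 1 && r s).toFinset)]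
  · refine Finset.sum_congr rfl fun s hs => ?_
    rw [List.mem_toFinset, List.mem_filter, Bool.and_eq_true, Nat.beq_eq] at hs
    rw [count]
    congr 1
    ext S
    simp only [Finset.mem_filter, mem_spanPaths, Finset.mem_powerset, spanPath_iff hp.tmem]
    constructor
    · rintro ⟨⟨⟨h1, h2, h3⟩, h4⟩, h5⟩
      exact ⟨h1, h2, h5⟩
    · rintro ⟨h1, h2, rfl⟩
      exact ⟨⟨⟨h1, h2, hs.2.1⟩, hs.2.2⟩, rfl⟩
  · intro S hS
    simp only [Finset.coe_filter, Set.mem_ofPred_eq, mem_spanPaths, spanPath_iff hp.tmem] at hS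
    obtain ⟨⟨hSE, hg, hcl⟩, hr⟩ := hS
    rw [Finset.mem_coe, List.mem_toFinset, List.mem_filter, Bool.and_eq_true, Nat.beq_eq]
    refine ⟨hp.mem_states hSE hg ?_, hcl, hr⟩
    have h0 := hg.deg_le _ (hp.tmem 0)
    have h1 := hg.deg_le _ (hp.tmem 1)
    have h2 := hg.deg_le _ (hp.tmem 2)
    rw [St.weight, hcl, St.degs]
    simp only [stateOf]
    omega

end Bridge

section Counting

theorem f_eq (n : ℕ) (u v : ℝ × ℝ) : f n u v = Nat.card (HamWalks (Vf n) (Ef n) u v) := by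
  unfold f IsHamPath G
  rw [← coe_Ef, ← coe_Vf]
  rfl

theorem two_le_card_Vf (n : ℕ) : 2 ≤ (Vf n).card := by
  have h : Finset.univ.map ⟨outm n, outm_injective n⟩ ⊆ Vf n := by
    intro v hv
    obtain ⟨l, -, rfl⟩ := Finset.mem_map.1 hv
    exact outm_mem n l
  have := Finset.card_le_card h
  rw [Finset.card_map, Finset.card_univ, Fintype.card_fin] at this
  omega

theorem finsum_f (n : ℕ) (u : ℝ × ℝ) : ∑ᶠ v, f n u v = ∑ v ∈ Vf n, f n u v := by
  refine finsum_eq_sum_of_support_subset _ fun v hv => ?_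
  by_contra h
  exact hv ((f_eq n u v).trans (card_hamWalks_of_notMem (Or.inr h)))

theorem H_eq (n : ℕ) : H n = 3 * val n 0 + 3 * val n 2 + val n 9 := by
  have hp := piece_SG n
  have h1 : ∑ᶠ u, ∑ᶠ v, f n u v = ∑ u ∈ Vf n, ∑ v ∈ Vf n, f n u v := by
    simp only [finsum_f]
    refine finsum_eq_sum_of_support_subset _ fun u hu => ?_
    by_contra h
    exact hu (Finset.sum_eq_zero fun v _ =>
      (f_eq n u v).trans (card_hamWalks_of_notMem (Or.inl h)))
  have h2 := hp.card_spanPaths fun _ => true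
  rw [Finset.filter_true_of_mem fun _ _ => rfl] at h2
  rw [H, h1]
  simp only [f_eq]
  rw [sum_sum_card_hamWalks hp.emem hp.ediag (two_le_card_Vf n), Nat.mul_div_cancel _ two_pos, h2]
  have hl : (states.filter fun s => s.classes.beq 1 && true) =
      [⟨1, 1, 2, true, true, true⟩, ⟨1, 2, 1, true, true, true⟩, ⟨1, 2, 2, true, true, true⟩,
       ⟨2, 1, 1, true, true, true⟩, ⟨2, 1, 2, true, true, true⟩, ⟨2, 2, 1, true, true, true⟩,
       ⟨2, 2, 2, true, true, true⟩] := rfl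
  rw [hl]
  simp only [List.map_cons, List.map_nil, List.sum_cons, List.sum_nil]
  rw [count_SG n (by decide), count_SG n (by decide), count_SG n (by decide),
    count_SG n (by decide), count_SG n (by decide), count_SG n (by decide),
    count_SG n (by decide)]
  simp only [St.cls, St.classes, St.degs, Bool.and_self, cond_true, cond_false, Nat.reduceAdd,
    Nat.beq]
  ring

theorem H0_eq (n : ℕ) : H0 n = 2 * val n 0 + val n 2 := by
  have hp := piece_SG n
  have h1 : H0 n = ∑ᶠ v, f n o v := by
    rw [H0, finsum_mem_def]
    refine finsum_congr fun v => ?_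
    by_cases h : v = o
    · subst h
      rw [f_eq, card_hamWalks_self (two_le_card_Vf n)]
      simp
    · exact Set.indicator_of_mem (by exact h) _
  have h2 := hp.card_spanPaths fun s => s.d0.beq 1
  rw [h1, finsum_f]
  simp only [f_eq]
  refine (sum_card_hamWalks hp.emem hp.ediag (two_le_card_Vf n) (outm_mem n 0)).trans ?_
  simp only [Nat.beq_eq] at h2
  refine h2.trans ?_
  have hl : (states.filter fun s => s.classes.beq 1 && s.d0.beq 1) =
      [⟨1, 1, 2, true, true, true⟩, ⟨1, 2, 1, true, true, true⟩, ⟨1, 2, 2, true, true, true⟩] := rfl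
  rw [hl]
  simp only [List.map_cons, List.map_nil, List.sum_cons, List.sum_nil]
  rw [count_SG n (by decide), count_SG n (by decide), count_SG n (by decide)]
  simp only [St.cls, St.classes, St.degs, Bool.and_self, cond_true, cond_false, Nat.reduceAdd,
    Nat.beq]
  ring

end Counting

section Asymptotics

/-- closed forms of the counts, for `x = 4 ^ n` and `y = 3 ^ n` -/
structure ClosedForm (w : ℕ → ℕ) (k x y : ℝ) : Prop where
  h0 : (w 0 : ℝ) = 2 * k
  h1 : (w 1 : ℝ) = 3 * k
  h2 : (w 2 : ℝ) = k * (119 / 216 * x - 4 / 27)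
  h3 : (w 3 : ℝ) = k * (119 / 144 * x - 7 / 18)
  h4 : (w 4 : ℝ) = k * (119 / 96 * x - 5 / 6)
  h5 : (w 5 : ℝ) = k * (119 / 72 * x - 47 / 18)
  h6 : (w 6 : ℝ) = k * (14161 / 67392 * x ^ 2 - 2023 / 2592 * x - 103 / 648 + 2827 / 8424 * y)
  h7 : (w 7 : ℝ) = k * (14161 / 22464 * x ^ 2 - 2261 / 864 * x + 223 / 72 + 2827 / 2808 * y)
  h8 : (w 8 : ℝ) = 0

theorem ClosedForm.succ {n : ℕ} {k x y : ℝ} (h : ClosedForm (val n) k x y) :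
    ClosedForm (val (n + 1)) (12 * k ^ 3) (4 * x) (3 * y) := by
  obtain ⟨h0, h1, h2, h3, h4, h5, h6, h7, h8⟩ := h
  constructor <;>
    simp only [val, coeffs, List.map_cons, List.map_nil, List.sum_cons, List.sum_nil] <;>
    push_cast <;> simp only [h0, h1, h2, h3, h4, h5, h6, h7, h8] <;> ring

theorem exists_closedForm (n : ℕ) : ∃ k : ℝ, 0 < k ∧
    ClosedForm (val (n + 2)) k (4 ^ (n + 2)) (3 ^ (n + 2)) := by
  induction n with
  | zero =>
    refine ⟨12, by norm_num, ?_⟩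
    constructor <;> norm_num [val, coeffs, baseVal]
  | succ n ih =>
    obtain ⟨k, hk, h⟩ := ih
    refine ⟨12 * k ^ 3, by positivity, ?_⟩
    rw [show (4 : ℝ) ^ (n + 1 + 2) = 4 * 4 ^ (n + 2) by ring,
      show (3 : ℝ) ^ (n + 1 + 2) = 3 * 3 ^ (n + 2) by ring]
    exact h.succ

theorem ratio_eq (n : ℕ) : (H (n + 3) : ℝ) / ((H0 (n + 3) : ℝ) * 4 ^ (n + 3)) =
    ((2 * 14161 / 67392 + 119 / 216 * (119 / 144)) +
      (3 * 119 / 54 + 2 * (119 / 144 - 2023 / 2592) - 119 / 216 * (7 / 18) -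
        4 / 27 * (119 / 144)) * (1 / 4) ^ (n + 2) +
      (6 - 3 * 4 / 27 - 2 * (7 / 18 + 103 / 648) + 4 / 27 * (7 / 18)) * ((1 / 4) ^ (n + 2)) ^ 2 +
      2 * 2827 / 8424 * (3 / 16) ^ (n + 2)) /
    (4 * (119 / 54 + (4 - 4 / 27) * (1 / 4) ^ (n + 2))) := by
  obtain ⟨k, hk, h⟩ := exists_closedForm n
  have h9 : (val (n + 3) 9 : ℝ) = 6 * (val (n + 2) 0 * val (n + 2) 0 * val (n + 2) 3) +
      (6 * (val (n + 2) 0 * val (n + 2) 0 * val (n + 2) 6) +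
      6 * (val (n + 2) 0 * val (n + 2) 2 * val (n + 2) 3)) := by
    simp only [val, coeffs, List.map_cons, List.map_nil, List.sum_cons, List.sum_nil]
    push_cast
    ring
  have hs := h.succ
  rw [H_eq, H0_eq]
  push_cast
  rw [h9, hs.h0, hs.h2, h.h0, h.h2, h.h3, h.h6]
  have hx : (1 : ℝ) ≤ 4 ^ (n + 2) := one_le_pow₀ (by norm_num)
  have e1 : ((1 : ℝ) / 4) ^ (n + 2) = 1 / 4 ^ (n + 2) := by rw [div_pow, one_pow]
  have e2 : ((3 : ℝ) / 16) ^ (n + 2) = 3 ^ (n + 2) / (4 ^ (n + 2)) ^ 2 := by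
    rw [div_pow, ← pow_mul, mul_comm (n + 2), pow_mul]
    norm_num
  have e3 : (4 : ℝ) ^ (n + 3) = 4 * 4 ^ (n + 2) := by ring
  rw [e1, e2, e3]
  generalize (4 : ℝ) ^ (n + 2) = x at *
  generalize (3 : ℝ) ^ (n + 2) = y at *
  have hx0 : x ≠ 0 := by positivity
  have d1 : 0 < 119 / 54 + (4 - 4 / 27) * (1 / x) := by positivity
  rw [div_eq_div_iff]
  · field_simp
    ring
  · have : 0 < 2 * (2 * (12 * k ^ 3)) + 12 * k ^ 3 * (119 / 216 * (4 * x) - 4 / 27) := by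
      have : 0 < k ^ 3 * (4 + 119 / 54 * x - 4 / 27) := by
        apply mul_pos (by positivity)
        linarith
      linarith
    positivity
  · positivity

end Asymptotics

/-- asymptotic ratio of `H n` to `H0 n`. -/
theorem H_div_H0_asymptotics :
    Filter.Tendsto (fun n : ℕ => (H n : ℝ) / ((H0 n : ℝ) * 4 ^ n))
      Filter.atTop (nhds (5 ^ 2 * 7 * 17 / (2 ^ 8 * 3 ^ 2 * 13))) := by
  rw [← tendsto_add_atTop_iff_nat 3]
  simp only [ratio_eq]
  have t1 : Tendsto (fun n : ℕ => ((1 : ℝ) / 4) ^ (n + 2)) atTop (𝓝 0) :=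
    (tendsto_add_atTop_iff_nat 2).2
      (tendsto_pow_atTop_nhds_zero_of_lt_one (by norm_num) (by norm_num))
  have t2 : Tendsto (fun n : ℕ => ((3 : ℝ) / 16) ^ (n + 2)) atTop (𝓝 0) :=
    (tendsto_add_atTop_iff_nat 2).2
      (tendsto_pow_atTop_nhds_zero_of_lt_one (by norm_num) (by norm_num))
  have hnum := ((t1.const_mul (3 * 119 / 54 + 2 * (119 / 144 - 2023 / 2592) -
      119 / 216 * (7 / 18) - 4 / 27 * (119 / 144))).const_add
    (2 * 14161 / 67392 + 119 / 216 * (119 / 144))).add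
    ((t1.pow 2).const_mul (6 - 3 * 4 / 27 - 2 * (7 / 18 + 103 / 648) + 4 / 27 * (7 / 18)))
  have hnum := hnum.add (t2.const_mul (2 * 2827 / 8424))
  have hden := ((t1.const_mul (4 - 4 / 27)).const_add (119 / 54)).const_mul 4
  refine Eq.subst (motive := fun z => Tendsto _ _ (𝓝 z)) ?_ (hnum.div hden (by norm_num))
  norm_num

end SierpinskiGasket
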